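/- arXiv:2510.05999 — 2 statements merged into one kernel-verified Lean document; each statement's English description precedes it below -/
import Mathlib

section
/- Let $N\ge3$ and let $\rho\in C^1([0,\infty))$ satisfy $\rho(0)=1$ and condition $(\rho_0)$ with some exponent $\gamma\ge0$. Let $a>0$, $b\le0$, $p=2^*$ and $q\in(1,\infty)$. Suppose $u$ is a nonnegative classical solution of problem $(\mathcal{P}_0)$ with $\int_{\mathbb{R}^N_+}\rho(x_N)|\nabla u|^2\,dx<\infty$, $u\in L^{2^*}(\mathbb{R}^N_+)$, and $u(\cdot,0)\in L^{2}(\mathbb{R}^{N-1})\cap L^{q}(\mathbb{R}^{N-1})$. Then $u\in L^\infty(\mathbb{R}^N_+)$ and $u(\cdot,0)\in L^\infty(\mathbb{R}^{N-1})$, i.e. $u$ is bounded on $\overline{\mathbb{R}^N_+}$. -/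
open MeasureTheory Filter
open scoped Topology ENNReal

noncomputable section

/-- The last coordinate of a point of `ℝ^N`. -/
def xN (N : ℕ) (hN : 0 < N) (x : EuclideanSpace ℝ (Fin N)) : ℝ :=
  x ⟨N - 1, Nat.sub_lt hN Nat.one_pos⟩

/-- The open upper half-space `ℝ^N₊`. -/
def Hplus (N : ℕ) (hN : 0 < N) : Set (EuclideanSpace ℝ (Fin N)) :=
  {x | 0 < xN N hN x}

/-- The point `(y, t) ∈ ℝ^N` with horizontal part `y ∈ ℝ^(N-1)` and last coordinate `t`. -/
def mkPt (N : ℕ) (y : EuclideanSpace ℝ (Fin (N - 1))) (t : ℝ) :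
    EuclideanSpace ℝ (Fin N) :=
  (WithLp.equiv 2 (Fin N → ℝ)).symm fun i => if h : (i : ℕ) < N - 1 then y ⟨(i : ℕ), h⟩ else t

/-- The boundary point `(y, 0)`. -/
def bPt (N : ℕ) (y : EuclideanSpace ℝ (Fin (N - 1))) : EuclideanSpace ℝ (Fin N) :=
  mkPt N y 0

/-- Partial derivative of `u` in the `i`-th coordinate direction. -/
def pd (N : ℕ) (u : EuclideanSpace ℝ (Fin N) → ℝ) (i : Fin N)
    (x : EuclideanSpace ℝ (Fin N)) : ℝ :=
  fderiv ℝ u x (EuclideanSpace.single i 1)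

/-- `div (w ∇u)` written as a sum of coordinate partial derivatives. -/
def divW (N : ℕ) (w u : EuclideanSpace ℝ (Fin N) → ℝ)
    (x : EuclideanSpace ℝ (Fin N)) : ℝ :=
  ∑ i, pd N (fun z => w z * pd N u i z) i x

/-- `u` is a (pointwise) solution of problem `(P₀)`:
`-div(ρ(x_N) ∇u) = a |u|^(p-2) u` in `ℝ^N₊` and
`-∂u/∂x_N = b |u|^(q-2) u` on `ℝ^(N-1)`. -/
def IsSolutionP0 (N : ℕ) (hN : 0 < N) (ρ : ℝ → ℝ) (a b p q : ℝ)
    (u : EuclideanSpace ℝ (Fin N) → ℝ) : Prop :=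
  (∀ x, 0 < xN N hN x →
    -divW N (fun z => ρ (xN N hN z)) u x = a * |u x| ^ (p - 2) * u x) ∧
  ∀ y : EuclideanSpace ℝ (Fin (N - 1)),
    -pd N u ⟨N - 1, Nat.sub_lt hN Nat.one_pos⟩ (bPt N y) =
      b * |u (bPt N y)| ^ (q - 2) * u (bPt N y)

lemma aux_iter (A B r : ℝ) (hA : 0 < A) (hB : 1 < B) (hr : 1 < r) :
    ∃ ε > 0, ∀ Y : ℕ → ℝ, (∀ j, 0 ≤ Y j) → Y 0 ≤ ε →
      (∀ j, Y (j+1) ≤ (A * B ^ j * Y j) ^ r) → Tendsto Y atTop (𝓝 0) := by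
  have hB0 : 0 < B := by linarith
  have hσ : 0 < r - 1 := by linarith
  set l : ℝ := B ^ (-(r / (r-1))) with hl
  have hl0 : 0 < l := Real.rpow_pos_of_pos hB0 _
  have hl1 : l < 1 := Real.rpow_lt_one_of_one_lt_of_neg hB (by
    have : 0 < r / (r-1) := by positivity
    linarith)
  set ε : ℝ := (l * A ^ (-r)) ^ (1 / (r-1)) with hε
  have hAr : 0 < A ^ (-r) := Real.rpow_pos_of_pos hA _
  have hε0 : 0 < ε := Real.rpow_pos_of_pos (by positivity) _
  have e1 : (A * ε) ^ r = ε * l := by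
    rw [Real.mul_rpow hA.le hε0.le]
    have : ε ^ r = ε * ε ^ (r - 1) := by
      rw [← Real.rpow_one_add' hε0.le (by linarith)]; ring_nf
    rw [this]
    have h2 : ε ^ (r-1) = l * A ^ (-r) := by
      rw [hε, ← Real.rpow_mul (by positivity), one_div_mul_cancel hσ.ne', Real.rpow_one]
    rw [h2, Real.rpow_neg hA.le]
    have : A ^ r ≠ 0 := (Real.rpow_pos_of_pos hA _).ne'
    field_simp
  have e2 : (l * B) ^ r = l := by
    rw [Real.mul_rpow hl0.le hB0.le]
    rw [hl, ← Real.rpow_mul hB0.le, ← Real.rpow_add hB0]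
    congr 1
    field_simp
    ring
  refine ⟨ε, hε0, fun Y hY h0 hs => ?_⟩
  have key : ∀ j, Y j ≤ ε * l ^ j := by
    intro j
    induction j with
    | zero => simpa using h0
    | succ j ih =>
      refine (hs j).trans ?_
      have h1 : A * B ^ j * Y j ≤ (A * ε) * (l * B) ^ j := by
        calc A * B ^ j * Y j ≤ A * B ^ j * (ε * l ^ j) := by gcongr
          _ = _ := by rw [mul_pow]; ring
      have h2 := Real.rpow_le_rpow (by have := hY j; positivity) h1 (by linarith : (0:ℝ) ≤ r)
      refine h2.trans (le_of_eq ?_)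
      rw [Real.mul_rpow (by positivity) (by positivity), e1, ← Real.rpow_natCast (l * B) j,
        ← Real.rpow_mul (by positivity), mul_comm (j:ℝ) r, Real.rpow_mul (by positivity), e2,
        Real.rpow_natCast, pow_succ]
      ring
  have ht : Tendsto (fun j => ε * l ^ j) atTop (𝓝 0) := by
    simpa using (tendsto_pow_atTop_nhds_zero_of_lt_one hl0.le hl1).const_mul ε
  exact squeeze_zero hY key ht

lemma aux_prim (f : ℝ → ℝ) (hf : Continuous f) (k : ℝ) (h0 : ∀ s, s ≤ k → f s = 0)
    (hn : ∀ s, 0 ≤ f s) :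
    ∃ F : ℝ → ℝ, (∀ s, HasDerivAt F (f s) s) ∧ (∀ s, s ≤ k → F s = 0) ∧ (∀ s, 0 ≤ F s) ∧
      (∀ s c, k ≤ s → (∀ t, t ≤ s → f t ≤ c) → F s ≤ c * (s - k)) ∧
      (∀ s k', k ≤ k' → k' ≤ s → (∀ t, k' ≤ t → 1 ≤ f t) → s - k' ≤ F s) := by
  have hz : ∀ s, s ≤ k → ∫ x in k..s, f x = 0 := by
    intro s hs
    rw [intervalIntegral.integral_congr (g := fun _ => 0)]
    · simp
    · intro x hx
      rw [Set.uIcc_of_ge hs] at hx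
      exact h0 x hx.2
  refine ⟨fun s => ∫ x in k..s, f x, fun s => ?_, hz, fun s => ?_, ?_, ?_⟩
  · exact intervalIntegral.integral_hasDerivAt_right (hf.intervalIntegrable _ _)
      (hf.stronglyMeasurableAtFilter _ _) hf.continuousAt
  · rcases le_total s k with h | h
    · simp [hz s h]
    · exact intervalIntegral.integral_nonneg h (fun x _ => hn x)
  · intro s c hs hc
    have := intervalIntegral.integral_mono_on (μ := volume) hs (hf.intervalIntegrable k s)
      ((continuous_const (y := c)).intervalIntegrable k s) (fun x hx => hc x hx.2)
    simpa [mul_comm] using this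
  · intro s k' hk hs h1
    have h2 := intervalIntegral.integral_mono_on (μ := volume) hs
      ((continuous_const (y := (1:ℝ))).intervalIntegrable k' s) (hf.intervalIntegrable k' s)
      (fun x hx => h1 x hx.1)
    have h3 := intervalIntegral.integral_add_adjacent_intervals (μ := volume)
      (hf.intervalIntegrable k k') (hf.intervalIntegrable k' s)
    have h4 := intervalIntegral.integral_nonneg (μ := volume) hk (fun x _ => hn x)
    simp at h2
    show s - k' ≤ ∫ x in k..s, f x
    linarith

lemma aux_gG (k δ : ℝ) (hδ : 0 < δ) :
    ∃ g h G G1 G2 : ℝ → ℝ, (∀ s, HasDerivAt g (h s) s) ∧ Continuous h ∧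
      (∀ s, HasDerivAt G (G1 s) s) ∧ (∀ s, HasDerivAt G1 (G2 s) s) ∧ Continuous G2 ∧
      (∀ s, 0 ≤ G2 s) ∧ (∀ s, G2 s ≤ 1) ∧ (∀ s, (h s) ^ 2 ≤ G2 s) ∧
      (∀ s, 0 ≤ G1 s) ∧ (∀ s, G1 s ≤ max (s - k) 0) ∧
      (∀ s, 0 ≤ G s) ∧ (∀ s, G s ≤ (max (s - k) 0) ^ 2) ∧
      (∀ s, 0 ≤ g s) ∧ (∀ s, g s ≤ max (s - k) 0) ∧ (∀ s, max (s - (k + δ)) 0 ≤ g s) := by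
  set h : ℝ → ℝ := fun s => min 1 (max 0 ((s - k) / δ)) with hh
  have hc : Continuous h := by fun_prop
  have h0 : ∀ s, s ≤ k → h s = 0 := by
    intro s hs
    have : (s - k) / δ ≤ 0 := div_nonpos_of_nonpos_of_nonneg (by linarith) hδ.le
    simp [hh, max_eq_left this]
  have hn : ∀ s, 0 ≤ h s := fun s => by simp [hh]
  have h1 : ∀ s, h s ≤ 1 := fun s => by simp [hh]
  have hbig : ∀ s, k + δ ≤ s → 1 ≤ h s := by
    intro s hs
    have : 1 ≤ (s - k) / δ := by rw [le_div_iff₀ hδ]; linarith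
    simp [hh, this]
  obtain ⟨g, g1, g2, g3, g4, g5⟩ := aux_prim h hc k h0 hn
  obtain ⟨G1, a1, a2, a3, a4, a5⟩ := aux_prim (fun s => h s ^ 2) (by fun_prop) k
    (fun s hs => by simp [h0 s hs]) (fun s => by positivity)
  have cG1 : Continuous G1 := continuous_iff_continuousAt.2 fun s => (a1 s).continuousAt
  obtain ⟨G, b1, b2, b3, b4, b5⟩ := aux_prim G1 cG1 k a2 a3
  have hsq : ∀ s, h s ^ 2 ≤ 1 := fun s => pow_le_one₀ (hn s) (h1 s)
  have a6 : ∀ s, G1 s ≤ max (s - k) 0 := by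
    intro s
    rcases le_total s k with hs | hs
    · simp [a2 s hs]
    · have := a4 s 1 hs (fun t _ => hsq t)
      exact le_max_of_le_left (by linarith)
  refine ⟨g, h, G, G1, fun s => h s ^ 2, g1, hc, b1, a1, by fun_prop, fun s => by positivity, hsq,
    fun s => le_rfl, a3, a6, b3, ?_, g3, ?_, ?_⟩
  · intro s
    rcases le_total s k with hs | hs
    · simp [b2 s hs]
    · have := b4 s (s - k) hs (fun t ht => (a6 t).trans (max_le (by linarith) (by linarith)))
      rw [max_eq_left (by linarith)]; nlinarith
  · intro s
    rcases le_total s k with hs | hs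
    · simp [g2 s hs]
    · have := g4 s 1 hs (fun t _ => h1 t)
      exact le_max_of_le_left (by linarith)
  · intro s
    rcases le_total s (k+δ) with hs | hs
    · rw [max_eq_right (by linarith)]; exact g3 s
    · rw [max_eq_left (by linarith)]
      exact g5 s (k+δ) (by linarith) hs hbig

lemma aux_theta : ∃ M : ℝ, 0 < M ∧ (∀ s, |deriv Real.smoothTransition s| ≤ M) ∧
    (∀ s, 0 ≤ deriv Real.smoothTransition s) ∧
    (∀ s, s < 0 → deriv Real.smoothTransition s = 0) ∧
    (∀ s, 1 < s → deriv Real.smoothTransition s = 0) := by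
  have hc : Continuous (deriv Real.smoothTransition) :=
    (Real.smoothTransition.contDiff (n := 1)).continuous_deriv le_rfl
  have hneg : ∀ s, s < 0 → deriv Real.smoothTransition s = 0 := by
    intro s hs
    have : Real.smoothTransition =ᶠ[𝓝 s] fun _ => 0 := by
      filter_upwards [Iio_mem_nhds hs] with x hx
      exact Real.smoothTransition.zero_of_nonpos (le_of_lt hx)
    rw [this.deriv_eq]; simp
  have hpos : ∀ s, 1 < s → deriv Real.smoothTransition s = 0 := by
    intro s hs
    have : Real.smoothTransition =ᶠ[𝓝 s] fun _ => 1 := by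
      filter_upwards [Ioi_mem_nhds hs] with x hx
      exact Real.smoothTransition.one_of_one_le (le_of_lt hx)
    rw [this.deriv_eq]; simp
  have hmono : Monotone Real.smoothTransition := by
    exact Real.smoothTransition.monotone
  obtain ⟨C, hC⟩ := (isCompact_Icc (a := (0:ℝ)) (b := 1)).exists_bound_of_continuousOn hc.continuousOn
  refine ⟨|C| + 1, by positivity, fun s => ?_, fun s => hmono.deriv_nonneg, hneg, hpos⟩
  rcases lt_or_ge s 0 with h | h
  · rw [hneg s h]; simp; positivity
  rcases lt_or_ge 1 s with h' | h'
  · rw [hpos s h']; simp; positivity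
  have := hC s ⟨h, h'⟩
  rw [Real.norm_eq_abs] at this
  linarith [le_abs_self C]

lemma aux_div (N : ℕ) (i0 : Fin N) (V : Fin N → EuclideanSpace ℝ (Fin N) → ℝ)
    (hV : ∀ i, ContDiff ℝ 1 (V i)) (hc : ∀ i, HasCompactSupport (V i))
    (hb : ∀ x, x i0 = 0 → 0 ≤ V i0 x) :
    ∫ x in {x : EuclideanSpace ℝ (Fin N) | 0 < x i0}, ∑ i, pd N (V i) i x ≤ 0 := by
  obtain ⟨M, hM, hθM, hθn, hθ0, hθ1⟩ := aux_theta
  set θ := Real.smoothTransition with hθdef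
  set F : EuclideanSpace ℝ (Fin N) → ℝ := fun x => ∑ i, pd N (V i) i x with hF
  have hpdc : ∀ i, Continuous (fun x => pd N (V i) i x) := fun i =>
    ((hV i).continuous_fderiv one_ne_zero).clm_apply continuous_const
  have hpds : ∀ i, HasCompactSupport (fun x => pd N (V i) i x) := fun i =>
    (hc i).fderiv_apply ℝ _
  have hpdi : ∀ i, Integrable (fun x => pd N (V i) i x) := fun i =>
    (hpdc i).integrable_of_hasCompactSupport (hpds i)
  have hFi : Integrable F := integrable_finsetSum _ (fun i _ => hpdi i)
  have hTc : Continuous (fun x : EuclideanSpace ℝ (Fin N) => x i0) := by fun_prop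
  have hms : MeasurableSet {x : EuclideanSpace ℝ (Fin N) | 0 < x i0} :=
    (isOpen_lt continuous_const hTc).measurableSet
  -- cutoff
  set Θ : ℕ → EuclideanSpace ℝ (Fin N) → ℝ := fun n x => θ (n * x i0) with hΘ
  have hΘc : ∀ n, Continuous (Θ n) := fun n => by
    have := Real.smoothTransition.continuous
    fun_prop
  have hΘd : ∀ n x, HasFDerivAt (Θ n) ((n * deriv θ (n * x i0)) •
      (EuclideanSpace.proj i0 : EuclideanSpace ℝ (Fin N) →L[ℝ] ℝ)) x := by
    intro n x
    have h1 : HasDerivAt θ (deriv θ (n * x i0)) (n * x i0) :=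
      ((Real.smoothTransition.contDiff (n := 1)).differentiable one_ne_zero _).hasDerivAt
    have h2 : HasFDerivAt (fun x : EuclideanSpace ℝ (Fin N) => (n:ℝ) * x i0)
        ((n:ℝ) • (EuclideanSpace.proj i0 : EuclideanSpace ℝ (Fin N) →L[ℝ] ℝ)) x :=
      (EuclideanSpace.proj i0 : EuclideanSpace ℝ (Fin N) →L[ℝ] ℝ).hasFDerivAt.const_mul _
    have h3 := h1.comp_hasFDerivAt x h2
    rw [smul_smul, mul_comm] at h3
    exact h3
  have hΘpd : ∀ n i x, fderiv ℝ (Θ n) x (EuclideanSpace.single i 1) =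
      if i = i0 then n * deriv θ (n * x i0) else 0 := by
    intro n i x
    rw [(hΘd n x).fderiv]
    by_cases h : i = i0
    · simp [h]
    · simp [h, Ne.symm h]
  have hdc : Continuous (deriv θ) :=
    (Real.smoothTransition.contDiff (n := 1)).continuous_deriv le_rfl
  have hparts : ∀ n i, ∫ x, Θ n x * pd N (V i) i x =
      - ∫ x, (if i = i0 then n * deriv θ (n * x i0) else 0) * V i x := by
    intro n i
    have := integral_mul_fderiv_eq_neg_fderiv_mul_of_integrable (μ := volume) (𝕜 := ℝ)
      (f := Θ n) (g := V i) (v := EuclideanSpace.single i 1) ?_ ?_ ?_ ?_ ?_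
    · simp only [hΘpd] at this
      exact this
    · simp only [hΘpd]
      refine Continuous.integrable_of_hasCompactSupport ?_ (hc i).mul_left
      have := (hV i).continuous
      split_ifs <;> fun_prop
    · exact ((hΘc n).mul (hpdc i)).integrable_of_hasCompactSupport (hpds i).mul_left
    · exact ((hΘc n).mul (hV i).continuous).integrable_of_hasCompactSupport (hc i).mul_left
    · exact fun x _ => (hΘd n x).differentiableAt
    · exact fun x _ => (hV i).differentiable one_ne_zero x
  have hsum : ∀ n, ∫ x, Θ n x * F x = - ∫ x, (n * deriv θ (n * x i0)) * V i0 x := by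
    intro n
    have : ∀ x, Θ n x * F x = ∑ i, Θ n x * pd N (V i) i x := fun x => by
      rw [hF, Finset.mul_sum]
    simp only [this]
    rw [integral_finsetSum]
    · simp only [hparts]
      rw [Finset.sum_eq_single i0]
      · simp
      · intro b _ hb; simp [hb]
      · simp
    · intro i _
      exact ((hΘc n).mul (hpdc i)).integrable_of_hasCompactSupport (hpds i).mul_left
  -- limit of LHS
  have hlim : Tendsto (fun n => ∫ x, Θ n x * F x) atTop
      (𝓝 (∫ x in {x : EuclideanSpace ℝ (Fin N) | 0 < x i0}, F x)) := by
    rw [← integral_indicator hms]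
    refine tendsto_integral_of_dominated_convergence (fun x => |F x|)
      (fun n => ((hΘc n).aestronglyMeasurable).mul hFi.aestronglyMeasurable) hFi.abs ?_ ?_
    · intro n
      filter_upwards with x
      rw [Real.norm_eq_abs, abs_mul]
      have h1 : |Θ n x| ≤ 1 := by
        rw [abs_of_nonneg (Real.smoothTransition.nonneg _)]
        exact Real.smoothTransition.le_one _
      nlinarith [abs_nonneg (F x)]
    · filter_upwards with x
      by_cases hx : 0 < x i0
      · rw [Set.indicator_of_mem (by exact hx)]
        refine tendsto_const_nhds.congr' ?_
        obtain ⟨m, hm⟩ := exists_nat_gt (1 / x i0)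
        filter_upwards [eventually_ge_atTop m] with n hn
        have : (1:ℝ) ≤ n * x i0 := by
          rw [div_lt_iff₀ hx] at hm
          have : (m:ℝ) ≤ n := by exact_mod_cast hn
          nlinarith
        simp [hΘ, hθdef, Real.smoothTransition.one_of_one_le this]
      · rw [Set.indicator_of_notMem (by exact hx)]
        refine tendsto_const_nhds.congr' ?_
        filter_upwards with n
        have : (n:ℝ) * x i0 ≤ 0 := mul_nonpos_of_nonneg_of_nonpos (by positivity) (by linarith)
        simp [hΘ, hθdef, Real.smoothTransition.zero_of_nonpos this]
  -- bound of RHS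
  obtain ⟨C, hC⟩ := (hV i0).lipschitzWith_of_hasCompactSupport (hc i0) one_ne_zero
  set K := tsupport (V i0) with hK
  have hKc : IsCompact K := hc i0
  set κ : ℝ → ℝ := fun s => deriv θ s * |s| with hκ
  have hκM : ∀ s, |κ s| ≤ M := by
    intro s
    rcases lt_or_ge s 0 with h | h
    · simp [hκ, hθ0 s h, hM.le]
    rcases lt_or_ge 1 s with h' | h'
    · simp [hκ, hθ1 s h', hM.le]
    simp only [hκ]
    rw [abs_mul, abs_abs, abs_of_nonneg h]
    nlinarith [hθM s, abs_nonneg (deriv θ s)]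
  have hlow : ∀ x, - (K.indicator (fun x => (C:ℝ) * |x i0|) x) ≤ V i0 x := by
    intro x
    by_cases hx : x ∈ K
    · rw [Set.indicator_of_mem hx]
      set z := x - (x i0) • (EuclideanSpace.single i0 (1:ℝ)) with hz
      have hz0 : z i0 = 0 := by simp [hz]
      have h1 := hC.dist_le_mul x z
      have h2 : dist x z = |x i0| := by
        rw [dist_eq_norm, hz]; simp [norm_smul]
      rw [h2, Real.dist_eq] at h1
      have h3 := hb z hz0
      have h4 := abs_le.1 h1
      linarith [h4.1]
    · rw [Set.indicator_of_notMem hx, image_eq_zero_of_notMem_tsupport hx]; simp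
  have hRi : ∀ n : ℕ, Integrable (K.indicator (fun x : EuclideanSpace ℝ (Fin N) => C * κ (n * x i0))) := by
    intro n
    rw [integrable_indicator_iff hKc.measurableSet]
    exact (Continuous.continuousOn (by fun_prop)).integrableOn_compact hKc
  have hle : ∀ n : ℕ, ∫ x, Θ n x * F x ≤ ∫ x, K.indicator (fun x => C * κ (n * x i0)) x := by
    intro n
    rw [hsum, ← integral_neg]
    refine integral_mono ?_ (hRi n) ?_
    · refine (Continuous.integrable_of_hasCompactSupport ?_ (hc i0).mul_left).neg
      have := (hV i0).continuous
      fun_prop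
    · intro x
      have h1 := hlow x
      have h2 : 0 ≤ n * deriv θ (n * x i0) := mul_nonneg (by positivity) (hθn _)
      by_cases hx : x ∈ K
      · simp only [Set.indicator_of_mem hx] at h1 ⊢
        simp only [hκ, abs_mul, Nat.abs_cast]
        nlinarith [mul_le_mul_of_nonneg_left h1 h2]
      · simp [Set.indicator_of_notMem hx, image_eq_zero_of_notMem_tsupport hx]
  have hlim2 : Tendsto (fun n : ℕ => ∫ x, K.indicator (fun x => C * κ (n * x i0)) x) atTop
      (𝓝 (∫ x : EuclideanSpace ℝ (Fin N), (0:ℝ))) := by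
    refine tendsto_integral_of_dominated_convergence (K.indicator (fun _ => C * M))
      (fun n => (hRi n).aestronglyMeasurable) ?_ ?_ ?_
    · rw [integrable_indicator_iff hKc.measurableSet]
      exact continuous_const.continuousOn.integrableOn_compact hKc
    · intro n
      filter_upwards with x
      by_cases hx : x ∈ K
      · simp only [Set.indicator_of_mem hx]
        rw [Real.norm_eq_abs, abs_mul, NNReal.abs_eq]
        gcongr
        exact hκM _
      · simp [Set.indicator_of_notMem hx]
    · filter_upwards with x
      refine tendsto_const_nhds.congr' ?_
      by_cases hx : x ∈ K
      · simp only [Set.indicator_of_mem hx]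
        by_cases hx0 : 0 < x i0
        · obtain ⟨m, hm⟩ := exists_nat_gt (1 / x i0)
          filter_upwards [eventually_ge_atTop m] with n hn
          have : (1:ℝ) < n * x i0 := by
            rw [div_lt_iff₀ hx0] at hm
            have : (m:ℝ) ≤ n := by exact_mod_cast hn
            nlinarith
          simp [hκ, hθ1 _ this]
        · filter_upwards with n
          have : (n:ℝ) * x i0 ≤ 0 := mul_nonpos_of_nonneg_of_nonpos (by positivity) (by linarith)
          rcases this.lt_or_eq with h | h
          · simp [hκ, hθ0 _ h]
          · simp [hκ, h]
      · filter_upwards with n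
        simp [Set.indicator_of_notMem hx]
  have := le_of_tendsto_of_tendsto' hlim hlim2 hle
  simpa using this

lemma aux_sob0 (N : ℕ) (hN : 3 ≤ N) : ∃ S : ℝ, 0 < S ∧
    ∀ w : EuclideanSpace ℝ (Fin N) → ℝ, ContDiff ℝ 1 w → HasCompactSupport w →
      ∫ x, |w x| ^ (2 * (N : ℝ) / ((N : ℝ) - 2)) ≤
        (S * ∫ x, ‖fderiv ℝ w x‖ ^ 2) ^ ((2 * (N : ℝ) / ((N : ℝ) - 2)) / 2) := by
  have hN' : (3:ℝ) ≤ N := by exact_mod_cast hN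
  set p : ℝ := 2 * (N : ℝ) / ((N : ℝ) - 2) with hp
  have hp0 : 0 < p := div_pos (by linarith) (by linarith)
  set C : ℝ := ((SNormLESNormFDerivOfEqConst ℝ (volume : Measure (EuclideanSpace ℝ (Fin N))) (2:NNReal) : NNReal) : ℝ) with hC
  have hC0 : 0 ≤ C := NNReal.coe_nonneg _
  refine ⟨C ^ 2 + 1, by positivity, fun w hw hs => ?_⟩
  set p' : NNReal := ⟨p, hp0.le⟩ with hp'
  have hpc : (p' : ℝ) = p := rfl
  have hdim : Module.finrank ℝ (EuclideanSpace ℝ (Fin N)) = N := by simp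
  have key := eLpNorm_le_eLpNorm_fderiv_of_eq (F := ℝ)
    (volume : Measure (EuclideanSpace ℝ (Fin N))) hw hs (p := 2) (p' := p')
    (by norm_num) (by rw [hdim]; omega) (by
      rw [hdim, hpc, hp]
      have : (N:ℝ) - 2 ≠ 0 := by linarith
      have : (N:ℝ) ≠ 0 := by linarith
      push_cast
      field_simp)
  have m1 : MemLp w (p' : ℝ≥0∞) volume := hw.continuous.memLp_of_hasCompactSupport hs
  have m2 : MemLp (fderiv ℝ w) ((2:NNReal) : ℝ≥0∞) volume :=
    (hw.continuous_fderiv one_ne_zero).memLp_of_hasCompactSupport (hs.fderiv ℝ)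
  have hp'0 : (p' : ℝ≥0∞) ≠ 0 := by
    rw [ENNReal.coe_ne_zero]; intro h; rw [← NNReal.coe_eq_zero, hpc] at h; linarith
  rw [m1.eLpNorm_eq_integral_rpow_norm hp'0 ENNReal.coe_ne_top,
    m2.eLpNorm_eq_integral_rpow_norm (by simp) ENNReal.coe_ne_top] at key
  rw [← ENNReal.ofReal_coe_nnreal (p := SNormLESNormFDerivOfEqConst _ _ _), ← hC, ← ENNReal.ofReal_mul hC0, ENNReal.ofReal_le_ofReal_iff (by positivity)] at key
  simp only [ENNReal.coe_toReal, hpc, Real.norm_eq_abs, NNReal.coe_ofNat, Real.rpow_ofNat] at key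
  set A := ∫ x, |w x| ^ p
  set B := ∫ x, ‖fderiv ℝ w x‖ ^ 2
  have hA : 0 ≤ A := integral_nonneg fun x => by positivity
  have hB : 0 ≤ B := integral_nonneg fun x => by positivity
  have h1 := Real.rpow_le_rpow (by positivity) key hp0.le
  rw [← Real.rpow_mul hA, inv_mul_cancel₀ hp0.ne', Real.rpow_one] at h1
  refine h1.trans ?_
  have h2 : C * B ^ (2:ℝ)⁻¹ = (C ^ 2 * B) ^ (2:ℝ)⁻¹ := by
    rw [Real.mul_rpow (by positivity) hB, ← Real.rpow_natCast C 2, ← Real.rpow_mul hC0]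
    norm_num
  rw [h2, ← Real.rpow_mul (by positivity)]
  have h3 : (2:ℝ)⁻¹ * p = p / 2 := by ring
  rw [h3]
  apply Real.rpow_le_rpow (by positivity) _ (by positivity)
  nlinarith

def Ph (N : ℕ) (i0 : Fin N) (h : ℝ → ℝ) (x : EuclideanSpace ℝ (Fin N)) :
    EuclideanSpace ℝ (Fin N) := x + (h (x i0) - x i0) • EuclideanSpace.single i0 (1:ℝ)

lemma Ph_norm (N : ℕ) (i0 : Fin N) (h : ℝ → ℝ) (hh : ∀ t, |t| ≤ h t) (x) :
    ‖x‖ ≤ ‖Ph N i0 h x‖ := by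
  have : ‖Ph N i0 h x‖ ^ 2 = ‖x‖ ^ 2 + ((h (x i0)) ^ 2 - (x i0) ^ 2) := by
    rw [Ph, norm_add_sq_real, norm_smul, real_inner_smul_right, EuclideanSpace.inner_single_right]
    simp
    ring
  have h2 : (x i0) ^ 2 ≤ (h (x i0)) ^ 2 := sq_le_sq.2 ((hh _).trans (le_abs_self _))
  exact le_of_sq_le_sq (by linarith) (norm_nonneg _)

lemma Ph_supp (N : ℕ) (i0 : Fin N) (h : ℝ → ℝ) (hh : ∀ t, |t| ≤ h t)
    {F : Type*} [Zero F] (f : EuclideanSpace ℝ (Fin N) → F) (R : ℝ) (hf : ∀ x, R < ‖x‖ → f x = 0) :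
    ∀ x, R < ‖x‖ → f (Ph N i0 h x) = 0 := fun x hx => hf _ (hx.trans_le (Ph_norm N i0 h hh x))

lemma aux_supp {E F : Type*} [NormedAddCommGroup E] [Zero F] {f : E → F}
    (hf : HasCompactSupport f) : ∃ R : ℝ, ∀ x, R < ‖x‖ → f x = 0 := by
  obtain ⟨R, hR⟩ := hf.isCompact.isBounded.exists_norm_le
  exact ⟨R, fun x hx => image_eq_zero_of_notMem_tsupport fun h => absurd (hR x h) (by linarith)⟩

lemma Ph_lim (N : ℕ) (i0 : Fin N) (f : EuclideanSpace ℝ (Fin N) → ℝ) (hf : Continuous f)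
    (hs : HasCompactSupport f) :
    Tendsto (fun n : ℕ => ∫ x, f (Ph N i0 (fun t => √(t ^ 2 + (1 / ((n:ℝ) + 1)) ^ 2)) x)) atTop
      (𝓝 (2 * ∫ x in {x : EuclideanSpace ℝ (Fin N) | 0 < x i0}, f x)) := by
  obtain ⟨R, hR⟩ := aux_supp hs
  obtain ⟨B, hB⟩ := hs.exists_bound_of_continuous hf
  have hc : ∀ h : ℝ → ℝ, Continuous h → Continuous (fun x => f (Ph N i0 h x)) := by
    intro h hh
    unfold Ph
    fun_prop
  have hTc : Continuous (fun x : EuclideanSpace ℝ (Fin N) => x i0) := by fun_prop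
  have hms : MeasurableSet {x : EuclideanSpace ℝ (Fin N) | 0 < x i0} :=
    (isOpen_lt continuous_const hTc).measurableSet
  have hms' : MeasurableSet {x : EuclideanSpace ℝ (Fin N) | x i0 < 0} :=
    (isOpen_lt hTc continuous_const).measurableSet
  have hlim : Tendsto (fun n : ℕ => ∫ x, f (Ph N i0 (fun t => √(t ^ 2 + (1 / ((n:ℝ) + 1)) ^ 2)) x)) atTop
      (𝓝 (∫ x, f (Ph N i0 (fun t => |t|) x))) := by
    refine tendsto_integral_of_dominated_convergence ((Metric.closedBall 0 R).indicator fun _ => B)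
      (fun n => (hc _ (by fun_prop)).aestronglyMeasurable) ?_ ?_ ?_
    · rw [integrable_indicator_iff Metric.isClosed_closedBall.measurableSet]
      exact continuous_const.continuousOn.integrableOn_compact (isCompact_closedBall _ _)
    · intro n
      filter_upwards with x
      by_cases hx : x ∈ Metric.closedBall (0 : EuclideanSpace ℝ (Fin N)) R
      · rw [Set.indicator_of_mem hx]; exact hB _
      · rw [Set.indicator_of_notMem hx, Ph_supp N i0 _ _ f R hR x (by simpa using hx)]
        · simp
        · intro t
          rw [← Real.sqrt_sq_eq_abs]
          exact Real.sqrt_le_sqrt (by nlinarith [sq_nonneg (1 / ((n:ℝ) + 1))])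
    · filter_upwards with x
      have h0 : Tendsto (fun n : ℕ => √((x i0) ^ 2 + (1 / ((n:ℝ) + 1)) ^ 2)) atTop (𝓝 (|x i0|)) := by
        have h1 := (tendsto_one_div_add_atTop_nhds_zero_nat (𝕜 := ℝ))
        have h2 := ((h1.pow 2).const_add ((x i0) ^ 2)).sqrt
        simpa [Real.sqrt_sq_eq_abs] using h2
      refine (hf.tendsto _).comp ?_
      unfold Ph
      exact ((h0.sub_const _).smul_const _).const_add _
  convert hlim using 2
  -- reflection
  have hIntf : Integrable (fun x => f (Ph N i0 (fun t => |t|) x)) := by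
    refine (hc _ (by fun_prop)).integrable_of_hasCompactSupport ?_
    refine HasCompactSupport.of_support_subset_isCompact (isCompact_closedBall 0 R) ?_
    intro x hx
    by_contra h
    exact hx (Ph_supp N i0 _ (fun t => le_rfl) f R hR x (by simpa using h))
  set Rf : EuclideanSpace ℝ (Fin N) ≃ₗᵢ[ℝ] EuclideanSpace ℝ (Fin N) :=
    LinearIsometryEquiv.piLpCongrRight 2 (fun i => if i = i0 then LinearIsometryEquiv.neg ℝ
      else LinearIsometryEquiv.refl ℝ ℝ) with hRf
  have hRfa : ∀ x i, (Rf x) i = if i = i0 then - x i else x i := by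
    intro x i
    simp only [hRf, LinearIsometryEquiv.piLpCongrRight_apply]
    split_ifs <;> simp
  have hz : ∀ᵐ x : EuclideanSpace ℝ (Fin N), x i0 ≠ 0 := by
    have := Measure.addHaar_submodule (volume : Measure (EuclideanSpace ℝ (Fin N)))
      (LinearMap.ker (EuclideanSpace.proj i0 : EuclideanSpace ℝ (Fin N) →L[ℝ] ℝ).toLinearMap) ?_
    · rw [ae_iff]
      convert this using 2
      ext x; simp
    · intro h
      have h1 : EuclideanSpace.single i0 (1:ℝ) ∈ (LinearMap.ker (EuclideanSpace.proj i0 : EuclideanSpace ℝ (Fin N) →L[ℝ] ℝ).toLinearMap) := by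
        rw [h]; trivial
      simp at h1
  have hsplit : ∫ x, f (Ph N i0 (fun t => |t|) x) =
      (∫ x in {x : EuclideanSpace ℝ (Fin N) | 0 < x i0}, f (Ph N i0 (fun t => |t|) x)) +
      ∫ x in {x : EuclideanSpace ℝ (Fin N) | x i0 < 0}, f (Ph N i0 (fun t => |t|) x) := by
    rw [← setIntegral_union _ hms' hIntf.integrableOn hIntf.integrableOn, ← setIntegral_univ]
    · refine setIntegral_congr_set ?_
      filter_upwards [hz] with x hx
      simp only [eq_iff_iff]
      constructor
      · intro _
        rcases lt_or_gt_of_ne hx with h | h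
        · right; exact h
        · left; exact h
      · intro _; trivial
    · rw [Set.disjoint_left]
      intro x hx hx'
      simp at hx hx'
      linarith
  rw [hsplit, two_mul]
  congr 1
  · refine setIntegral_congr_fun hms ?_
    intro x hx
    have : 0 < x i0 := hx
    simp [Ph, abs_of_pos this]
  · have h1 := (Rf.measurePreserving).setIntegral_preimage_emb
      (Rf.toHomeomorph.measurableEmbedding) f {x : EuclideanSpace ℝ (Fin N) | 0 < x i0}
    rw [← h1]
    have h2 : Rf ⁻¹' {x : EuclideanSpace ℝ (Fin N) | 0 < x i0} = {x | x i0 < 0} := by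
      ext x; simp [hRfa]
    rw [h2]
    refine setIntegral_congr_fun hms' ?_
    intro x hx
    have hx' : x i0 < 0 := hx
    show f (Rf x) = f _
    congr 1
    ext i
    rw [hRfa]
    by_cases h : i = i0
    · subst h; simp [Ph, abs_of_neg hx']
    · simp [Ph, h]

lemma aux_norm_coord {N : ℕ} (x : EuclideanSpace ℝ (Fin N)) (i : Fin N) : |x i| ≤ ‖x‖ := by
  simpa using PiLp.norm_apply_le x i

lemma Ph_deriv (N : ℕ) (i0 : Fin N) (ε : ℝ) (hε : 0 < ε) (w : EuclideanSpace ℝ (Fin N) → ℝ)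
    (hw : ContDiff ℝ 1 w) :
    ContDiff ℝ 1 (fun x => w (Ph N i0 (fun t => √(t ^ 2 + ε ^ 2)) x)) ∧
    ∀ x, ‖fderiv ℝ (fun x => w (Ph N i0 (fun t => √(t ^ 2 + ε ^ 2)) x)) x‖ ≤
      3 * ‖fderiv ℝ w (Ph N i0 (fun t => √(t ^ 2 + ε ^ 2)) x)‖ := by
  have hpos : ∀ t : ℝ, 0 < t ^ 2 + ε ^ 2 := fun t => by positivity
  have hpr : ∀ x : EuclideanSpace ℝ (Fin N), HasFDerivAt (fun x : EuclideanSpace ℝ (Fin N) => x i0)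
      (EuclideanSpace.proj i0 : EuclideanSpace ℝ (Fin N) →L[ℝ] ℝ) x := fun x =>
    (EuclideanSpace.proj i0 : EuclideanSpace ℝ (Fin N) →L[ℝ] ℝ).hasFDerivAt
  have hprc : ContDiff ℝ 1 (fun x : EuclideanSpace ℝ (Fin N) => x i0) :=
    (EuclideanSpace.proj i0 : EuclideanSpace ℝ (Fin N) →L[ℝ] ℝ).contDiff
  constructor
  · refine hw.comp ?_
    unfold Ph
    refine contDiff_id.add (ContDiff.smul (ContDiff.sub ?_ hprc) contDiff_const)
    exact ContDiff.sqrt (by fun_prop) (fun x => (hpos _).ne')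
  · intro x
    set s := √((x i0) ^ 2 + ε ^ 2) with hs
    have hs0 : 0 < s := Real.sqrt_pos.2 (hpos _)
    have hd : HasDerivAt (fun t : ℝ => √(t ^ 2 + ε ^ 2)) (x i0 / s) (x i0) := by
      have h1 : HasDerivAt (fun t : ℝ => t ^ 2 + ε ^ 2) (2 * x i0) (x i0) := by
        simpa using (hasDerivAt_pow 2 (x i0)).add_const (ε ^ 2)
      have h2 := h1.sqrt (hpos _).ne'
      convert h2 using 1
      rw [← hs]; field_simp
    have hle : |x i0 / s| ≤ 1 := by
      rw [abs_div, abs_of_pos hs0, div_le_one hs0, hs]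
      rw [← Real.sqrt_sq_eq_abs]
      exact Real.sqrt_le_sqrt (by nlinarith [sq_nonneg ε])
    have hΦ : HasFDerivAt (Ph N i0 (fun t => √(t ^ 2 + ε ^ 2)))
        (ContinuousLinearMap.id ℝ _ + (((x i0 / s) • (EuclideanSpace.proj i0 : EuclideanSpace ℝ (Fin N) →L[ℝ] ℝ)) -
          (EuclideanSpace.proj i0 : EuclideanSpace ℝ (Fin N) →L[ℝ] ℝ)).smulRight (EuclideanSpace.single i0 (1:ℝ))) x := by
      unfold Ph
      refine (hasFDerivAt_id x).add (HasFDerivAt.smul_const (HasFDerivAt.sub ?_ (hpr x)) _)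
      exact HasDerivAt.comp_hasFDerivAt (h₂ := fun t : ℝ => √(t ^ 2 + ε ^ 2)) (f := fun x : EuclideanSpace ℝ (Fin N) => x i0) x hd (hpr x)
    have hcomp := ((hw.differentiable one_ne_zero _).hasFDerivAt (x := Ph N i0 (fun t => √(t ^ 2 + ε ^ 2)) x)).comp x hΦ
    have hcomp' : fderiv ℝ (fun x => w (Ph N i0 (fun t => √(t ^ 2 + ε ^ 2)) x)) x = _ := hcomp.fderiv
    rw [hcomp']
    refine (ContinuousLinearMap.opNorm_comp_le _ _).trans ?_
    rw [mul_comm]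
    refine mul_le_mul_of_nonneg_right ?_ (norm_nonneg _)
    refine ContinuousLinearMap.opNorm_le_bound _ (by norm_num) fun y => ?_
    simp only [add_apply, ContinuousLinearMap.smulRight_apply, sub_apply,
      smul_apply, ContinuousLinearMap.id_apply]
    refine (norm_add_le _ _).trans ?_
    rw [norm_smul]
    have h1 := aux_norm_coord y i0
    have h2 : ‖(x i0 / s) • (EuclideanSpace.proj i0 : EuclideanSpace ℝ (Fin N) →L[ℝ] ℝ) y -
        (EuclideanSpace.proj i0 : EuclideanSpace ℝ (Fin N) →L[ℝ] ℝ) y‖ ≤ 2 * ‖y‖ := by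
      change ‖x i0 / s * y i0 - y i0‖ ≤ 2 * ‖y‖
      rw [Real.norm_eq_abs]
      have h3 : |x i0 / s * y i0 - y i0| ≤ |x i0 / s| * |y i0| + |y i0| := by
        rw [← abs_mul]; exact abs_sub _ _
      nlinarith [abs_nonneg (y i0)]
    have h4 : ‖EuclideanSpace.single i0 (1:ℝ)‖ = 1 := by simp
    rw [h4]
    linarith

lemma aux_sob1 (N : ℕ) (hN : 3 ≤ N) (i0 : Fin N) : ∃ S : ℝ, 0 < S ∧
    ∀ w : EuclideanSpace ℝ (Fin N) → ℝ, ContDiff ℝ 1 w → HasCompactSupport w →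
      ∫ x in {x : EuclideanSpace ℝ (Fin N) | 0 < x i0}, |w x| ^ (2 * (N : ℝ) / ((N : ℝ) - 2)) ≤
        (S * ∫ x in {x : EuclideanSpace ℝ (Fin N) | 0 < x i0}, ‖fderiv ℝ w x‖ ^ 2) ^
          ((2 * (N : ℝ) / ((N : ℝ) - 2)) / 2) := by
  have hN' : (3:ℝ) ≤ N := by exact_mod_cast hN
  obtain ⟨S, hS, hsob⟩ := aux_sob0 N hN
  set p : ℝ := 2 * (N : ℝ) / ((N : ℝ) - 2) with hp
  have hp0 : 0 < p := div_pos (by linarith) (by linarith)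
  refine ⟨S * 9 * 2, by positivity, fun w hw hs => ?_⟩
  set ε : ℕ → ℝ := fun n => 1 / ((n:ℝ) + 1) with hε
  have hε0 : ∀ n, 0 < ε n := fun n => by positivity
  have hwp : Continuous (fun x => |w x| ^ p) := by
    have := hw.continuous
    exact (this.abs).rpow_const (fun x => Or.inr hp0.le)
  have hdp : Continuous (fun x => ‖fderiv ℝ w x‖ ^ 2) := by
    have := hw.continuous_fderiv one_ne_zero
    fun_prop
  have hwps : HasCompactSupport (fun x => |w x| ^ p) :=
    hs.comp_left (g := fun t : ℝ => |t| ^ p) (by simp [hp0.ne'])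
  have hdps : HasCompactSupport (fun x => ‖fderiv ℝ w x‖ ^ 2) :=
    (hs.fderiv ℝ).comp_left (g := fun t => ‖t‖ ^ 2) (by simp)
  have l1 := Ph_lim N i0 _ hwp hwps
  have l2 := Ph_lim N i0 _ hdp hdps
  obtain ⟨R, hR⟩ := aux_supp hs
  obtain ⟨R', hR'⟩ := aux_supp hdps
  have hPh : ∀ n : ℕ, ∀ t : ℝ, |t| ≤ √(t ^ 2 + (ε n) ^ 2) := by
    intro n t
    rw [← Real.sqrt_sq_eq_abs]
    exact Real.sqrt_le_sqrt (by nlinarith [sq_nonneg (ε n)])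
  have hcs : ∀ {F : Type} [Zero F] (f : EuclideanSpace ℝ (Fin N) → F) (R : ℝ),
      (∀ x, R < ‖x‖ → f x = 0) → HasCompactSupport f := by
    intro F _ f R hf
    refine HasCompactSupport.of_support_subset_isCompact (isCompact_closedBall 0 R) ?_
    intro x hx
    by_contra h
    exact hx (hf x (by simpa using h))
  have hcsn : ∀ n, HasCompactSupport (fun x => w (Ph N i0 (fun t => √(t ^ 2 + (ε n) ^ 2)) x)) :=
    fun n => hcs _ R (Ph_supp N i0 _ (hPh n) w R hR)
  have hle : ∀ n : ℕ, ∫ x, |w (Ph N i0 (fun t => √(t ^ 2 + (ε n) ^ 2)) x)| ^ p ≤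
      (S * 9 * ∫ x, ‖fderiv ℝ w (Ph N i0 (fun t => √(t ^ 2 + (ε n) ^ 2)) x)‖ ^ 2) ^ (p / 2) := by
    intro n
    obtain ⟨d1, d2⟩ := Ph_deriv N i0 (ε n) (hε0 n) w hw
    refine (hsob _ d1 (hcsn n)).trans ?_
    refine Real.rpow_le_rpow (mul_nonneg hS.le (integral_nonneg fun x => by positivity)) ?_ (by positivity)
    rw [mul_assoc]
    refine mul_le_mul_of_nonneg_left ?_ hS.le
    rw [← integral_const_mul]
    refine integral_mono ?_ ?_ fun x => ?_
    · refine Continuous.integrable_of_hasCompactSupport ?_ ?_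
      · have := d1.continuous_fderiv one_ne_zero
        fun_prop
      · exact ((hcsn n).fderiv ℝ).comp_left (g := fun t => ‖t‖ ^ 2) (by simp)
    · refine (Continuous.integrable_of_hasCompactSupport ?_ ?_).const_mul _
      · have := hw.continuous_fderiv one_ne_zero
        refine hdp.comp ?_
        unfold Ph
        fun_prop
      · exact hcs _ R' (Ph_supp N i0 _ (hPh n) _ R' hR')
    · have := pow_le_pow_left₀ (norm_nonneg _) (d2 x) 2
      calc _ ≤ _ := this
        _ = _ := by ring
  have l3 := ((l2.const_mul (S * 9)).rpow_const (p := p / 2) (Or.inr (by positivity)))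
  have l4 := le_of_tendsto_of_tendsto' l1 l3 hle
  have hI : 0 ≤ ∫ x in {x : EuclideanSpace ℝ (Fin N) | 0 < x i0}, |w x| ^ p :=
    integral_nonneg fun x => by positivity
  rw [← mul_assoc] at l4
  linarith

lemma aux_cut (N : ℕ) : ∃ η : EuclideanSpace ℝ (Fin N) → ℝ, ContDiff ℝ 2 η ∧ HasCompactSupport η ∧
    (∀ x, 0 ≤ η x) ∧ (∀ x, η x ≤ 1) ∧ (∀ x, ‖x‖ ≤ 1 → η x = 1) := by
  let f : ContDiffBump (0 : EuclideanSpace ℝ (Fin N)) := ⟨1, 2, by norm_num, by norm_num⟩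
  refine ⟨f, f.contDiff, f.hasCompactSupport, fun x => f.nonneg, fun x => f.le_one, fun x hx => ?_⟩
  exact f.one_of_mem_closedBall (by simpa using hx)

lemma aux_sob2 (N : ℕ) (hN : 3 ≤ N) (i0 : Fin N) : ∃ S : ℝ, 0 < S ∧
    ∀ w : EuclideanSpace ℝ (Fin N) → ℝ, ContDiff ℝ 1 w →
      IntegrableOn (fun x => |w x| ^ (2 * (N : ℝ) / ((N : ℝ) - 2))) {x | 0 < x i0} →
      IntegrableOn (fun x => (w x) ^ 2) {x | 0 < x i0} →
      IntegrableOn (fun x => ‖fderiv ℝ w x‖ ^ 2) {x | 0 < x i0} →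
      ∫ x in {x : EuclideanSpace ℝ (Fin N) | 0 < x i0}, |w x| ^ (2 * (N : ℝ) / ((N : ℝ) - 2)) ≤
        (S * ∫ x in {x : EuclideanSpace ℝ (Fin N) | 0 < x i0}, ‖fderiv ℝ w x‖ ^ 2) ^
          ((2 * (N : ℝ) / ((N : ℝ) - 2)) / 2) := by
  have hN' : (3:ℝ) ≤ N := by exact_mod_cast hN
  obtain ⟨S, hS, hsob⟩ := aux_sob1 N hN i0
  set p : ℝ := 2 * (N : ℝ) / ((N : ℝ) - 2) with hp
  have hp0 : 0 < p := div_pos (by linarith) (by linarith)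
  refine ⟨S * 2, by positivity, fun w hw h1 h2 h3 => ?_⟩
  set H : Set (EuclideanSpace ℝ (Fin N)) := {x | 0 < x i0} with hH
  obtain ⟨η, ηc, ηs, η0, η1, ηone⟩ := aux_cut N
  have ηc1 : ContDiff ℝ 1 η := ηc.of_le (by norm_num)
  obtain ⟨D, hD⟩ := (ηs.fderiv ℝ).exists_bound_of_continuous (ηc1.continuous_fderiv one_ne_zero)
  have hD0 : 0 ≤ D := (norm_nonneg _).trans (hD 0)
  set r : ℕ → ℝ := fun n => 1 / ((n:ℝ) + 1) with hr
  have hr0 : ∀ n, 0 < r n := fun n => by positivity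
  set v : ℕ → EuclideanSpace ℝ (Fin N) → ℝ := fun n x => η (r n • x) * w x with hv
  have hηn : ∀ n, ContDiff ℝ 1 (fun x => η (r n • x)) := fun n =>
    ηc1.comp (contDiff_const_smul (r n))
  have hvc : ∀ n, ContDiff ℝ 1 (v n) := fun n => (hηn n).mul hw
  have hηs : ∀ n, HasCompactSupport (fun x => η (r n • x)) := fun n =>
    ηs.comp_homeomorph (Homeomorph.smulOfNeZero (r n) (hr0 n).ne')
  have hvs : ∀ n, HasCompactSupport (v n) := fun n => (hηs n).mul_right
  have hder : ∀ n x, ‖fderiv ℝ (v n) x‖ ^ 2 ≤ 2 * ‖fderiv ℝ w x‖ ^ 2 + (2 * D ^ 2 * (r n) ^ 2) * (w x) ^ 2 := by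
    intro n x
    have e1 : HasFDerivAt (fun x => η (r n • x)) ((fderiv ℝ η (r n • x)).comp (r n • ContinuousLinearMap.id ℝ _)) x :=
      ((ηc1.differentiable one_ne_zero _).hasFDerivAt).comp x ((hasFDerivAt_id x).const_smul (r n))
    have e2 := e1.mul ((hw.differentiable one_ne_zero x).hasFDerivAt)
    have e3 : fderiv ℝ (v n) x = _ := e2.fderiv
    have e4 : ‖fderiv ℝ (v n) x‖ ≤ ‖fderiv ℝ w x‖ + |w x| * (D * r n) := by
      rw [e3]
      refine (norm_add_le _ _).trans ?_
      rw [norm_smul, norm_smul, Real.norm_eq_abs, Real.norm_eq_abs, abs_of_nonneg (η0 _)]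
      have b1 : ‖(fderiv ℝ η (r n • x)).comp (r n • ContinuousLinearMap.id ℝ (EuclideanSpace ℝ (Fin N)))‖ ≤ D * r n := by
        rw [ContinuousLinearMap.comp_smul, ContinuousLinearMap.comp_id, norm_smul, Real.norm_eq_abs,
          abs_of_pos (hr0 n), mul_comm]
        exact mul_le_mul_of_nonneg_right (hD _) (hr0 n).le
      refine add_le_add ?_ (mul_le_mul_of_nonneg_left b1 (abs_nonneg _))
      have := η1 (r n • x)
      nlinarith [norm_nonneg (fderiv ℝ w x)]
    have e5 := pow_le_pow_left₀ (norm_nonneg _) e4 2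
    refine e5.trans ?_
    have e6 : (w x) ^ 2 = |w x| ^ 2 := (sq_abs _).symm
    rw [e6]
    nlinarith [sq_nonneg (‖fderiv ℝ w x‖ - |w x| * (D * r n))]
  have hle : ∀ n, ∫ x in H, |v n x| ^ p ≤ (S * (2 * (∫ x in H, ‖fderiv ℝ w x‖ ^ 2) +
      (2 * D ^ 2 * (r n) ^ 2) * ∫ x in H, (w x) ^ 2)) ^ (p / 2) := by
    intro n
    refine (hsob _ (hvc n) (hvs n)).trans ?_
    refine Real.rpow_le_rpow (mul_nonneg hS.le (integral_nonneg fun x => by positivity)) ?_ (by positivity)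
    refine mul_le_mul_of_nonneg_left ?_ hS.le
    rw [← integral_const_mul, ← integral_const_mul, ← integral_add (h3.const_mul _) (h2.const_mul _)]
    refine integral_mono ?_ ((h3.const_mul _).add (h2.const_mul _)) (hder n)
    refine (Continuous.integrable_of_hasCompactSupport ?_ ?_).integrableOn
    · have := (hvc n).continuous_fderiv one_ne_zero
      fun_prop
    · exact ((hvs n).fderiv ℝ).comp_left (g := fun t => ‖t‖ ^ 2) (by simp)
  have hrl : Tendsto r atTop (𝓝 0) := tendsto_one_div_add_atTop_nhds_zero_nat
  have l1 : Tendsto (fun n => ∫ x in H, |v n x| ^ p) atTop (𝓝 (∫ x in H, |w x| ^ p)) := by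
    refine tendsto_integral_of_dominated_convergence (fun x => |w x| ^ p) (fun n => ?_) h1 ?_ ?_
    · exact (((hvc n).continuous.abs).rpow_const (fun x => Or.inr hp0.le)).aestronglyMeasurable
    · intro n
      filter_upwards with x
      rw [Real.norm_eq_abs, abs_of_nonneg (by positivity)]
      refine Real.rpow_le_rpow (abs_nonneg _) ?_ hp0.le
      simp only [hv, abs_mul, abs_of_nonneg (η0 _)]
      have := η1 (r n • x)
      nlinarith [abs_nonneg (w x)]
    · filter_upwards with x
      refine tendsto_const_nhds.congr' ?_
      have : Tendsto (fun n => ‖r n • x‖) atTop (𝓝 0) := by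
        have := (hrl.smul_const x).norm
        simpa using this
      filter_upwards [this.eventually (ge_mem_nhds (zero_lt_one))] with n hn
      simp [hv, ηone _ hn]
  have l2 : Tendsto (fun n => (S * (2 * (∫ x in H, ‖fderiv ℝ w x‖ ^ 2) +
      (2 * D ^ 2 * (r n) ^ 2) * ∫ x in H, (w x) ^ 2)) ^ (p / 2)) atTop
      (𝓝 ((S * (2 * (∫ x in H, ‖fderiv ℝ w x‖ ^ 2) +
      (2 * D ^ 2 * 0 ^ 2) * ∫ x in H, (w x) ^ 2)) ^ (p / 2))) :=
    ((((((hrl.pow 2).const_mul _).mul_const _).const_add _).const_mul S).rpow_const (Or.inr (by positivity)))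
  have l3 := le_of_tendsto_of_tendsto' l1 l2 hle
  refine l3.trans (le_of_eq ?_)
  congr 1
  ring

lemma aux_cut1 (ρ : ℝ → ℝ) (hρ : ContDiff ℝ 1 ρ) (hρ1 : ∀ s, 0 ≤ s → 1 ≤ ρ s)
    (ε m : ℝ) (hε : 0 < ε) (hm : 0 < m) :
    ∃ (c : ℝ → ℝ) (T : ℝ), ContDiff ℝ 2 c ∧ (∀ t, 0 ≤ c t) ∧ (∀ t, c t ≤ 1) ∧
      (∀ t, -1 ≤ t → t ≤ m → c t = 1) ∧ (∀ t, t ≤ -2 → c t = 0) ∧ (∀ t, T ≤ t → c t = 0) ∧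
      (∀ t, 0 < t → deriv (fun s => ρ s * deriv c s) t ≤ ε) := by
  obtain ⟨M, hM, hθM, hθn, hθ0, hθ1⟩ := aux_theta
  set θ := Real.smoothTransition with hθdef
  have θc : ContDiff ℝ 2 θ := Real.smoothTransition.contDiff (n := 2)
  have θd : ∀ s, HasDerivAt θ (deriv θ s) s := fun s =>
    (θc.differentiable two_ne_zero s).hasDerivAt
  have θnn : ∀ s, 0 ≤ θ s := Real.smoothTransition.nonneg
  have θle : ∀ s, θ s ≤ 1 := Real.smoothTransition.le_one
  have θz : ∀ s, s ≤ 0 → θ s = 0 := fun s hs => Real.smoothTransition.zero_of_nonpos hs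
  have θo : ∀ s, 1 ≤ s → θ s = 1 := fun s hs => Real.smoothTransition.one_of_one_le hs
  have hpc : ContinuousOn (fun s => 1 / ρ s) (Set.Icc (m+1) (m+2)) :=
    continuousOn_const.div hρ.continuous.continuousOn (fun s hs => by
      have := hρ1 s (by linarith [hs.1]); linarith)
  have hpi : IntervalIntegrable (fun s => 1 / ρ s) volume (m+1) (m+2) := by
    apply ContinuousOn.intervalIntegrable
    rwa [Set.uIcc_of_le (by linarith)]
  set z : ℝ := ∫ s in (m+1)..(m+2), 1 / ρ s with hz
  have hz0 : 0 < z := intervalIntegral.intervalIntegral_pos_of_pos_on hpi (fun s hs => by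
    have := hρ1 s (by linarith [hs.1]); positivity) (by linarith)
  set L : ℝ := M / (z * ε) with hL
  have hL0 : 0 < L := by positivity
  set ζ : ℝ → ℝ := fun t => θ (t - m) * (1 - θ ((t - m - 2) / L)) with hζ
  have ζc : ContDiff ℝ 1 ζ := by
    have := θc.of_le (show (1 : WithTop ℕ∞) ≤ 2 by norm_num)
    exact (this.comp (contDiff_id.sub contDiff_const)).mul
      (contDiff_const.sub (this.comp (((contDiff_id.sub contDiff_const).sub contDiff_const).div_const L)))
  have ζn : ∀ t, 0 ≤ ζ t := fun t => mul_nonneg (θnn _) (by linarith [θle ((t - m - 2) / L)])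
  have ζz : ∀ t, t ≤ m → ζ t = 0 := fun t ht => by simp [hζ, θz (t - m) (by linarith)]
  have ζz' : ∀ t, m + 2 + L ≤ t → ζ t = 0 := fun t ht => by
    have : 1 ≤ (t - m - 2) / L := by rw [le_div_iff₀ hL0]; linarith
    simp [hζ, θo _ this]
  have ζd : ∀ t, - (M / L) ≤ deriv ζ t := by
    intro t
    have d1 : HasDerivAt (fun t => θ (t - m)) (deriv θ (t - m)) t :=
      (θd (t - m)).comp_sub_const t m
    have d2 : HasDerivAt (fun t => θ ((t - m - 2) / L)) (deriv θ ((t - m - 2) / L) * (1 / L)) t := by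
      have : HasDerivAt (fun t : ℝ => (t - m - 2) / L) (1 / L) t :=
        (((hasDerivAt_id t).sub_const m).sub_const 2).div_const L
      exact HasDerivAt.comp t (θd _) this
    have d3 := d1.mul (d2.const_sub 1)
    have d4 : deriv ζ t = _ := d3.deriv
    rw [d4]
    have e1 : 0 ≤ deriv θ (t - m) * (1 - θ ((t - m - 2) / L)) :=
      mul_nonneg (hθn _) (by linarith [θle ((t - m - 2) / L)])
    have e2 : deriv θ ((t - m - 2) / L) ≤ M := (le_abs_self _).trans (hθM _)
    have e3 : θ (t - m) * deriv θ ((t - m - 2) / L) ≤ M := by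
      nlinarith [θle (t - m), θnn (t - m), hθn ((t - m - 2) / L)]
    have e4 : θ (t - m) * (deriv θ ((t - m - 2) / L) * (1 / L)) ≤ M / L := by
      rw [← mul_assoc, mul_one_div]; gcongr
    linarith
  set f : ℝ → ℝ := fun t => ζ t / ρ t with hf
  have fc : ContDiff ℝ 1 f := by
    rw [contDiff_iff_contDiffAt]
    intro t
    rcases lt_or_ge t m with h | h
    · have : f =ᶠ[𝓝 t] fun _ => 0 := by
        filter_upwards [Iio_mem_nhds h] with s hs
        simp [hf, ζz s (le_of_lt hs)]
      exact contDiffAt_const.congr_of_eventuallyEq this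
    · exact ζc.contDiffAt.div hρ.contDiffAt (by have := hρ1 t (by linarith); linarith)
  have fn : ∀ t, 0 ≤ f t := by
    intro t
    rcases lt_or_ge t m with h | h
    · simp [hf, ζz t h.le]
    · exact div_nonneg (ζn t) (by have := hρ1 t (by linarith); linarith)
  have fcc := fc.continuous
  set F : ℝ → ℝ := fun s => ∫ x in m..s, f x with hF
  have Fd : ∀ s, HasDerivAt F (f s) s := fun s =>
    intervalIntegral.integral_hasDerivAt_right (fcc.intervalIntegrable _ _)
      (fcc.stronglyMeasurableAtFilter _ _) fcc.continuousAt
  have Fm : Monotone F := monotone_of_hasDerivAt_nonneg Fd fn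
  have F0 : ∀ s, s ≤ m → F s = 0 := by
    intro s hs
    simp only [hF]
    rw [intervalIntegral.integral_congr (g := fun _ => 0)]
    · simp
    · intro x hx
      rw [Set.uIcc_of_ge hs] at hx
      simp [hf, ζz x hx.2]
  have F1 : ∀ s, m + 2 + L ≤ s → F s = F (m + 2 + L) := by
    intro s hs
    have h1 := intervalIntegral.integral_add_adjacent_intervals (μ := volume)
      (fcc.intervalIntegrable m (m+2+L)) (fcc.intervalIntegrable (m+2+L) s)
    have h2 : ∫ x in (m+2+L)..s, f x = 0 := by
      rw [intervalIntegral.integral_congr (g := fun _ => 0)]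
      · simp
      · intro x hx
        rw [Set.uIcc_of_le hs] at hx
        simp [hf, ζz' x hx.1]
    simp only [hF]
    linarith
  set Z := F (m + 2 + L) with hZ
  have hzZ : z ≤ Z := by
    have h1 := intervalIntegral.integral_add_adjacent_intervals (μ := volume)
      (fcc.intervalIntegrable m (m+1)) (fcc.intervalIntegrable (m+1) (m+2))
    have h2 : ∫ x in (m+1)..(m+2), f x = z := by
      refine intervalIntegral.integral_congr ?_
      intro x hx
      rw [Set.uIcc_of_le (by linarith)] at hx
      have a1 : 1 ≤ x - m := by linarith [hx.1]
      have a2 : (x - m - 2) / L ≤ 0 := div_nonpos_of_nonpos_of_nonneg (by linarith [hx.2]) hL0.le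
      simp [hf, hζ, θo _ a1, θz _ a2]
    have h3 : 0 ≤ F (m+1) := by rw [← F0 m le_rfl]; exact Fm (by linarith)
    have h4 : F (m+2) ≤ Z := Fm (by linarith)
    simp only [hF] at h3 h4
    linarith
  have hZ0 : 0 < Z := by linarith
  set c0 : ℝ → ℝ := fun t => 1 - F t / Z with hc0
  have c0d : ∀ t, HasDerivAt c0 (-(f t / Z)) t := fun t => ((Fd t).div_const Z).const_sub 1
  have c0c : ContDiff ℝ 2 c0 := by
    have : ContDiff ℝ (1 + 1) c0 := by
      rw [contDiff_succ_iff_deriv]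
      refine ⟨fun t => (c0d t).differentiableAt, by simp, ?_⟩
      have : deriv c0 = fun t => -(f t / Z) := funext fun t => (c0d t).deriv
      rw [this]
      exact (fc.div_const Z).neg
    simpa [one_add_one_eq_two] using this
  have c0n : ∀ t, 0 ≤ c0 t := by
    intro t
    have : F t ≤ Z := by
      rcases le_total t (m+2+L) with h | h
      · exact Fm h
      · exact (F1 t h).le
    have : F t / Z ≤ 1 := by rw [div_le_one hZ0]; exact this
    simp only [hc0]; linarith
  have Fn : ∀ t, 0 ≤ F t := by
    intro t
    rcases le_total t m with h | h
    · exact (F0 t h).ge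
    · rw [← F0 m le_rfl]; exact Fm h
  have c0l : ∀ t, c0 t ≤ 1 := by
    intro t
    have : 0 ≤ F t / Z := div_nonneg (Fn t) hZ0.le
    simp only [hc0]; linarith
  refine ⟨fun t => θ (t + 2) * c0 t, m + 2 + L, ?_, ?_, ?_, ?_, ?_, ?_, ?_⟩
  · exact (θc.comp (contDiff_id.add contDiff_const)).mul c0c
  · exact fun t => mul_nonneg (θnn _) (c0n _)
  · exact fun t => mul_le_one₀ (θle _) (c0n _) (c0l _)
  · intro t h1 h2
    simp [θo (t + 2) (by linarith), hc0, F0 t h2]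
  · intro t ht
    simp [θz (t + 2) (by linarith)]
  · intro t ht
    simp [hc0, F1 t ht, div_self hZ0.ne']
  · intro t ht
    have hev : (fun s => ρ s * deriv (fun t => θ (t + 2) * c0 t) s) =ᶠ[𝓝 t] fun s => -(ζ s / Z) := by
      filter_upwards [Ioi_mem_nhds ht] with s hs
      have hs' : 0 < s := hs
      have : (fun t => θ (t + 2) * c0 t) =ᶠ[𝓝 s] c0 := by
        filter_upwards [Ioi_mem_nhds hs'] with r hr
        have hr' : 0 < r := hr
        simp [θo (r + 2) (by linarith)]
      rw [this.deriv_eq, (c0d s).deriv]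
      have := hρ1 s hs'.le
      have : ρ s ≠ 0 := by linarith
      simp only [hf]
      field_simp
    rw [hev.deriv_eq]
    have hd : HasDerivAt (fun s => -(ζ s / Z)) (-(deriv ζ t / Z)) t :=
      (((ζc.differentiable one_ne_zero t).hasDerivAt).div_const Z).neg
    rw [hd.deriv, ← neg_div, div_le_iff₀ hZ0]
    have h1 := ζd t
    have h2 : M / L = z * ε := by rw [hL]; field_simp
    nlinarith

lemma aux_pdprod (N : ℕ) (i0 : Fin N) (r : ℝ) (f : ℝ → ℝ) (ψ : EuclideanSpace ℝ (Fin N) → ℝ)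
    (hψ : Differentiable ℝ ψ) (i : Fin N) (x : EuclideanSpace ℝ (Fin N))
    (hf : DifferentiableAt ℝ f (x i0)) :
    pd N (fun z => f (z i0) * ψ (r • (z - z i0 • EuclideanSpace.single i0 (1:ℝ)))) i x =
      if i = i0 then deriv f (x i0) * ψ (r • (x - x i0 • EuclideanSpace.single i0 (1:ℝ)))
      else f (x i0) * (r * pd N ψ i (r • (x - x i0 • EuclideanSpace.single i0 (1:ℝ)))) := by
  have hpr : HasFDerivAt (fun x : EuclideanSpace ℝ (Fin N) => x i0)
      (EuclideanSpace.proj i0 : EuclideanSpace ℝ (Fin N) →L[ℝ] ℝ) x :=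
    (EuclideanSpace.proj i0 : EuclideanSpace ℝ (Fin N) →L[ℝ] ℝ).hasFDerivAt
  have h1 : HasFDerivAt (fun x : EuclideanSpace ℝ (Fin N) => f (x i0)) _ x :=
    HasDerivAt.comp_hasFDerivAt (h₂ := f) (f := fun x : EuclideanSpace ℝ (Fin N) => x i0) x
      hf.hasDerivAt hpr
  have h2 := (((hasFDerivAt_id x).sub (hpr.smul_const (EuclideanSpace.single i0 (1:ℝ)))).const_smul r)
  have h3 : HasFDerivAt (fun z : EuclideanSpace ℝ (Fin N) => ψ (r • (z - z i0 • EuclideanSpace.single i0 (1:ℝ)))) _ x :=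
    HasFDerivAt.comp x (hψ _).hasFDerivAt h2
  have h4 : fderiv ℝ (fun z => f (z i0) * ψ (r • (z - z i0 • EuclideanSpace.single i0 (1:ℝ)))) x
      = _ := (h1.mul h3).fderiv
  unfold pd
  rw [h4]
  by_cases h : i = i0
  · subst h
    simp
    ring
  · simp [h, Ne.symm h]

lemma aux_cutoff (N : ℕ) (i0 : Fin N) (ρ : ℝ → ℝ) (hρ : ContDiff ℝ 1 ρ)
    (hρ1 : ∀ s, 0 ≤ s → 1 ≤ ρ s) (ε m : ℝ) (hε : 0 < ε) (hm : 0 < m) :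
    ∃ χ : EuclideanSpace ℝ (Fin N) → ℝ, ContDiff ℝ 2 χ ∧ HasCompactSupport χ ∧
      (∀ x, 0 ≤ χ x) ∧ (∀ x, χ x ≤ 1) ∧ (∀ x, 0 ≤ x i0 → ‖x‖ ≤ m → χ x = 1) ∧
      (∀ x, x i0 = 0 → pd N χ i0 x = 0) ∧
      (∀ x, 0 < x i0 → divW N (fun z => ρ (z i0)) χ x ≤ ε) := by
  obtain ⟨c, T, cc, c0, c1, cone, cz, cT, cd⟩ := aux_cut1 ρ hρ hρ1 (ε/2) m (by positivity) hm
  obtain ⟨η, ηc, ηs, η0, η1, ηone⟩ := aux_cut N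
  have ηpd : ∀ i, ContDiff ℝ 1 (fun x => pd N η i x) := fun i =>
    (ηc.fderiv_right (m := 1) (by norm_num [one_add_one_eq_two])).clm_apply contDiff_const
  have ηpds : ∀ i, HasCompactSupport (fun x => pd N η i x) := fun i => ηs.fderiv_apply ℝ _
  have hb : ∀ i, ∃ D, ∀ x, |pd N (fun x => pd N η i x) i x| ≤ D := by
    intro i
    obtain ⟨D, hD⟩ := ((ηpds i).fderiv_apply ℝ (EuclideanSpace.single i (1:ℝ))).exists_bound_of_continuous
      (((ηpd i).continuous_fderiv one_ne_zero).clm_apply continuous_const)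
    exact ⟨D, hD⟩
  choose D hD using hb
  have hD0 : ∀ i, 0 ≤ D i := fun i => (abs_nonneg _).trans (hD i 0)
  obtain ⟨B, hB⟩ := (isCompact_Icc (a := (0:ℝ)) (b := |T|)).exists_bound_of_continuousOn
    hρ.continuous.continuousOn
  have hB0 : 0 ≤ B := (norm_nonneg _).trans (hB 0 ⟨le_rfl, abs_nonneg _⟩)
  set Q : ℝ := B * ∑ i, D i with hQ
  have hQ0 : 0 ≤ Q := mul_nonneg hB0 (Finset.sum_nonneg fun i _ => hD0 i)
  obtain ⟨r, hr0, hr1, hr2, hr3⟩ : ∃ r : ℝ, 0 < r ∧ r ≤ 1 ∧ r * (2 * m) ≤ 1 ∧ r * Q ≤ ε / 2 := by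
    refine ⟨min 1 (min (1 / (2 * m)) (ε / 2 / (Q + 1))), by positivity, min_le_left _ _, ?_, ?_⟩
    · have : min 1 (min (1 / (2 * m)) (ε / 2 / (Q + 1))) ≤ 1 / (2 * m) :=
        (min_le_right _ _).trans (min_le_left _ _)
      rwa [le_div_iff₀ (by positivity)] at this
    · have : min 1 (min (1 / (2 * m)) (ε / 2 / (Q + 1))) ≤ ε / 2 / (Q + 1) :=
        (min_le_right _ _).trans (min_le_right _ _)
      rw [le_div_iff₀ (by positivity)] at this
      have h2 : 0 < min 1 (min (1 / (2 * m)) (ε / 2 / (Q + 1))) := by positivity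
      nlinarith
  set P : EuclideanSpace ℝ (Fin N) → EuclideanSpace ℝ (Fin N) := fun x =>
    r • (x - x i0 • EuclideanSpace.single i0 (1:ℝ)) with hP
  have hxc : ContDiff ℝ 2 (fun x : EuclideanSpace ℝ (Fin N) => x i0) :=
    (EuclideanSpace.proj i0 : EuclideanSpace ℝ (Fin N) →L[ℝ] ℝ).contDiff
  have hPc : ContDiff ℝ 2 P := (contDiff_id.sub (hxc.smul contDiff_const)).const_smul r
  have cdiff : Differentiable ℝ c := cc.differentiable two_ne_zero
  have cdc : ContDiff ℝ 1 (deriv c) := by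
    have : ContDiff ℝ (1 + 1) c := by simpa [one_add_one_eq_two] using cc
    exact ((contDiff_succ_iff_deriv).1 this).2.2
  have ηd : Differentiable ℝ η := ηc.differentiable two_ne_zero
  have hpd1 : ∀ i x, pd N (fun z => c (z i0) * η (P z)) i x =
      if i = i0 then deriv c (x i0) * η (P x) else c (x i0) * (r * pd N η i (P x)) :=
    fun i x => aux_pdprod N i0 r c η ηd i x (cdiff _)
  refine ⟨fun x => c (x i0) * η (P x), (cc.comp hxc).mul (ηc.comp hPc), ?_, ?_, ?_, ?_, ?_, ?_⟩
  · obtain ⟨R, hR⟩ := aux_supp ηs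
    refine HasCompactSupport.of_support_subset_isCompact (isCompact_closedBall 0 (R / r + |T| + 2)) ?_
    intro x hx
    rw [Function.mem_support] at hx
    have h1 : c (x i0) ≠ 0 := left_ne_zero_of_mul hx
    have h2 : η (P x) ≠ 0 := right_ne_zero_of_mul hx
    have h3 : ‖P x‖ ≤ R := by
      by_contra h; exact h2 (hR _ (by linarith))
    have h4 : |x i0| ≤ |T| + 2 := by
      rw [abs_le]
      constructor
      · by_contra h; exact h1 (cz _ (by linarith [abs_nonneg T]))
      · by_contra h; exact h1 (cT _ (by linarith [le_abs_self T]))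
    have h5 : ‖x - x i0 • EuclideanSpace.single i0 (1:ℝ)‖ ≤ R / r := by
      rw [le_div_iff₀ hr0]
      simp only [hP, norm_smul, Real.norm_eq_abs, abs_of_pos hr0] at h3
      linarith
    have h6 : ‖x i0 • EuclideanSpace.single i0 (1:ℝ)‖ = |x i0| := by simp [norm_smul]
    have h7 := norm_add_le (x - x i0 • EuclideanSpace.single i0 (1:ℝ)) (x i0 • EuclideanSpace.single i0 (1:ℝ))
    rw [sub_add_cancel, h6] at h7
    simp only [Metric.mem_closedBall, dist_zero_right]
    linarith
  · exact fun x => mul_nonneg (c0 _) (η0 _)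
  · exact fun x => mul_le_one₀ (c1 _) (η0 _) (η1 _)
  · intro x hx hxm
    have h0 := (le_abs_self _).trans (aux_norm_coord x i0)
    have h6 : ‖x i0 • EuclideanSpace.single i0 (1:ℝ)‖ = |x i0| := by simp [norm_smul]
    have h7 := norm_sub_le x (x i0 • EuclideanSpace.single i0 (1:ℝ))
    have h8 := aux_norm_coord x i0
    rw [h6] at h7
    have h9 : ‖P x‖ ≤ 1 := by
      simp only [hP, norm_smul, Real.norm_eq_abs, abs_of_pos hr0]
      refine le_trans ?_ hr2
      exact mul_le_mul_of_nonneg_left (by linarith) hr0.le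
    simp only [cone _ (by linarith : -1 ≤ x i0) (by linarith), ηone _ h9, mul_one]
  · intro x hx
    rw [hpd1, if_pos rfl, hx]
    have : c =ᶠ[𝓝 0] fun _ => 1 := by
      filter_upwards [Icc_mem_nhds (by norm_num : (-1:ℝ) < 0) hm] with t ht
      exact cone t ht.1 ht.2
    rw [this.deriv_eq]; simp
  · intro x hx
    have hterm : ∀ i, pd N (fun z => ρ (z i0) * pd N (fun z => c (z i0) * η (P z)) i z) i x =
        if i = i0 then deriv (fun s => ρ s * deriv c s) (x i0) * η (P x)
        else (ρ (x i0) * c (x i0) * r) * (r * pd N (fun z => pd N η i z) i (P x)) := by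
      intro i
      by_cases h : i = i0
      · have e : (fun z => ρ (z i0) * pd N (fun z => c (z i0) * η (P z)) i z) =
            fun z => (fun s => ρ s * deriv c s) (z i0) * η (P z) := by
          funext z; rw [hpd1, if_pos h]; ring
        rw [e, if_pos h]
        have := aux_pdprod N i0 r (fun s => ρ s * deriv c s) η ηd i x
          ((hρ.mul cdc).differentiable one_ne_zero _)
        rw [if_pos h] at this
        exact this
      · have e : (fun z => ρ (z i0) * pd N (fun z => c (z i0) * η (P z)) i z) =
            fun z => (fun s => ρ s * c s * r) (z i0) * (fun y => pd N η i y) (P z) := by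
          funext z; rw [hpd1, if_neg h]; ring
        rw [e, if_neg h]
        have := aux_pdprod N i0 r (fun s => ρ s * c s * r) (fun y => pd N η i y)
          ((ηpd i).differentiable one_ne_zero) i x
          (((hρ.differentiable one_ne_zero _).mul (cdiff _)).mul_const r)
        rw [if_neg h] at this
        exact this
    unfold divW
    have hbd : ∀ i, pd N (fun z => ρ (z i0) * pd N (fun z => c (z i0) * η (P z)) i z) i x ≤
        (if i = i0 then ε / 2 else 0) + r * (B * D i) := by
      intro i
      rw [hterm]
      by_cases h : i = i0
      · rw [if_pos h, if_pos h]
        have h1 := cd (x i0) hx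
        have h2 : deriv (fun s => ρ s * deriv c s) (x i0) * η (P x) ≤ ε / 2 := by
          nlinarith [η0 (P x), η1 (P x)]
        have h3 : 0 ≤ r * (B * D i) := by have := hD0 i; positivity
        linarith
      · rw [if_neg h, if_neg h, zero_add]
        have h1 : |ρ (x i0) * c (x i0)| ≤ B := by
          rcases le_total T (x i0) with hT | hT
          · simp [cT _ hT, hB0]
          · have := hB (x i0) ⟨hx.le, hT.trans (le_abs_self T)⟩
            rw [abs_mul, abs_of_nonneg (c0 _)]
            rw [Real.norm_eq_abs] at this
            nlinarith [c0 (x i0), c1 (x i0), abs_nonneg (ρ (x i0))]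
        have h2 := hD i (P x)
        calc ρ (x i0) * c (x i0) * r * (r * pd N (fun z => pd N η i z) i (P x))
            = (r * r) * ((ρ (x i0) * c (x i0)) * pd N (fun z => pd N η i z) i (P x)) := by ring
          _ ≤ (r * r) * (B * D i) := by
              refine mul_le_mul_of_nonneg_left ?_ (by positivity)
              refine (le_abs_self _).trans ?_
              rw [abs_mul]
              exact mul_le_mul h1 h2 (abs_nonneg _) hB0
          _ ≤ r * (B * D i) := by
              refine mul_le_mul_of_nonneg_right ?_ (mul_nonneg hB0 (hD0 i))
              nlinarith
    refine (Finset.sum_le_sum fun i _ => hbd i).trans ?_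
    rw [Finset.sum_add_distrib, ← Finset.mul_sum, ← Finset.mul_sum]
    simp
    linarith

lemma pd_mul' {N : ℕ} {f g : EuclideanSpace ℝ (Fin N) → ℝ} (i : Fin N)
    (x : EuclideanSpace ℝ (Fin N)) (hf : DifferentiableAt ℝ f x) (hg : DifferentiableAt ℝ g x) :
    pd N (fun z => f z * g z) i x = pd N f i x * g x + f x * pd N g i x := by
  have h4 : fderiv ℝ (fun z => f z * g z) x = _ := (hf.hasFDerivAt.mul hg.hasFDerivAt).fderiv
  unfold pd
  rw [h4]
  simp
  ring

lemma pd_sub' {N : ℕ} {f g : EuclideanSpace ℝ (Fin N) → ℝ} (i : Fin N)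
    (x : EuclideanSpace ℝ (Fin N)) (hf : DifferentiableAt ℝ f x) (hg : DifferentiableAt ℝ g x) :
    pd N (fun z => f z - g z) i x = pd N f i x - pd N g i x := by
  have h4 : fderiv ℝ (fun z => f z - g z) x = _ := (hf.hasFDerivAt.sub hg.hasFDerivAt).fderiv
  unfold pd
  rw [h4]
  simp

lemma pd_comp' {N : ℕ} {F : ℝ → ℝ} {u : EuclideanSpace ℝ (Fin N) → ℝ} (i : Fin N)
    (x : EuclideanSpace ℝ (Fin N)) (c : ℝ) (hF : HasDerivAt F c (u x))
    (hg : DifferentiableAt ℝ u x) :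
    pd N (fun z => F (u z)) i x = c * pd N u i x := by
  have h4 : fderiv ℝ (fun z => F (u z)) x = _ :=
    (HasDerivAt.comp_hasFDerivAt (h₂ := F) x hF hg.hasFDerivAt).fderiv
  unfold pd
  rw [h4]
  simp

lemma pd_contDiff {N : ℕ} {u : EuclideanSpace ℝ (Fin N) → ℝ} (hu : ContDiff ℝ 2 u) (i : Fin N) :
    ContDiff ℝ 1 (pd N u i) := by
  unfold pd
  exact (hu.fderiv_right (m := 1) (by norm_num)).clm_apply contDiff_const

lemma pd_cont {N : ℕ} {u : EuclideanSpace ℝ (Fin N) → ℝ} (hu : ContDiff ℝ 1 u) (i : Fin N) :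
    Continuous (pd N u i) := by
  unfold pd
  exact (hu.continuous_fderiv (by norm_num)).clm_apply continuous_const

lemma pd_supp {N : ℕ} {u : EuclideanSpace ℝ (Fin N) → ℝ} (hu : HasCompactSupport u) (i : Fin N) :
    HasCompactSupport (pd N u i) := by
  unfold pd
  exact hu.fderiv_apply ℝ _

lemma pd_sumsq {N : ℕ} (u : EuclideanSpace ℝ (Fin N) → ℝ) (x : EuclideanSpace ℝ (Fin N))
    (h : DifferentiableAt ℝ u x) :
    ∑ i, (pd N u i x)^2 = ‖gradient u x‖^2 := by
  rw [EuclideanSpace.norm_sq_eq]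
  refine Finset.sum_congr rfl fun i _ => ?_
  have h1 : pd N u i x = gradient u x i := by
    have h2 : inner ℝ (gradient u x) (EuclideanSpace.single i (1:ℝ)) = pd N u i x := by
      unfold gradient pd
      rw [InnerProductSpace.toDual_symm_apply]
    rw [← h2, EuclideanSpace.inner_single_right]
    simp
  rw [h1, Real.norm_eq_abs, sq_abs]

lemma grad_norm {N : ℕ} (u : EuclideanSpace ℝ (Fin N) → ℝ) (x : EuclideanSpace ℝ (Fin N)) :
    ‖gradient u x‖ = ‖fderiv ℝ u x‖ := by
  unfold gradient
  simp

lemma aux_ptwise (N : ℕ) (i0 : Fin N) (ρ : ℝ → ℝ) (hρ : ContDiff ℝ 1 ρ)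
    (u χ : EuclideanSpace ℝ (Fin N) → ℝ) (hu : ContDiff ℝ 2 u) (hχ : ContDiff ℝ 2 χ)
    (G G1 G2 : ℝ → ℝ) (hG : ∀ s, HasDerivAt G (G1 s) s) (hG1 : ∀ s, HasDerivAt G1 (G2 s) s)
    (x : EuclideanSpace ℝ (Fin N)) :
    ∑ i, pd N (fun z => (χ z * G1 (u z)) * (ρ (z i0) * pd N u i z)
        - G (u z) * (ρ (z i0) * pd N χ i z)) i x
      = χ x * (G2 (u x) * (ρ (x i0) * ‖gradient u x‖^2))
        + χ x * (G1 (u x) * divW N (fun z => ρ (z i0)) u x)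
        - G (u x) * divW N (fun z => ρ (z i0)) χ x := by
  have hud : Differentiable ℝ u := hu.differentiable (by norm_num)
  have hχd : Differentiable ℝ χ := hχ.differentiable (by norm_num)
  have hρd : Differentiable ℝ (fun z : EuclideanSpace ℝ (Fin N) => ρ (z i0)) :=
    (hρ.differentiable (by norm_num)).comp (by fun_prop)
  have hA : ∀ i, Differentiable ℝ (fun z => ρ (z i0) * pd N u i z) := fun i =>
    hρd.mul ((pd_contDiff hu i).differentiable (by norm_num))
  have hB : ∀ i, Differentiable ℝ (fun z => ρ (z i0) * pd N χ i z) := fun i =>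
    hρd.mul ((pd_contDiff hχ i).differentiable (by norm_num))
  have hGd : Differentiable ℝ (fun z => G (u z)) := fun z =>
    ((hG (u z)).differentiableAt).comp z (hud z)
  have hG1d : Differentiable ℝ (fun z => G1 (u z)) := fun z =>
    ((hG1 (u z)).differentiableAt).comp z (hud z)
  rw [← pd_sumsq u x (hud x)]
  unfold divW
  simp only [Finset.mul_sum, ← Finset.sum_add_distrib, ← Finset.sum_sub_distrib]
  refine Finset.sum_congr rfl fun i _ => ?_
  have d1 : Differentiable ℝ (fun z => χ z * G1 (u z)) := hχd.mul hG1d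
  have d2 : Differentiable ℝ (fun z => (χ z * G1 (u z)) * (ρ (z i0) * pd N u i z)) :=
    d1.mul (hA i)
  have d3 : Differentiable ℝ (fun z => G (u z) * (ρ (z i0) * pd N χ i z)) := hGd.mul (hB i)
  rw [pd_sub' i x (d2 x) (d3 x), pd_mul' i x (d1 x) (hA i x), pd_mul' i x (hGd x) (hB i x),
    pd_mul' i x (hχd x) (hG1d x), pd_comp' i x _ (hG (u x)) (hud x),
    pd_comp' i x _ (hG1 (u x)) (hud x)]
  ring

lemma aux_en0 (N : ℕ) (i0 : Fin N) (ρ : ℝ → ℝ) (hρ : ContDiff ℝ 1 ρ)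
    (hρ0 : 0 ≤ ρ 0)
    (u χ : EuclideanSpace ℝ (Fin N) → ℝ) (hu : ContDiff ℝ 2 u) (hχ : ContDiff ℝ 2 χ)
    (hub : ∀ x : EuclideanSpace ℝ (Fin N), x i0 = 0 → 0 ≤ pd N u i0 x)
    (G G1 G2 : ℝ → ℝ) (hG : ∀ s, HasDerivAt G (G1 s) s) (hG1 : ∀ s, HasDerivAt G1 (G2 s) s)
    (hG2c : Continuous G2) (hG1n : ∀ s, 0 ≤ G1 s) (hGn : ∀ s, 0 ≤ G s)
    (ε : ℝ) (hχs : HasCompactSupport χ) (hχ0 : ∀ x, 0 ≤ χ x)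
    (hχb : ∀ x : EuclideanSpace ℝ (Fin N), x i0 = 0 → pd N χ i0 x = 0)
    (hχε : ∀ x : EuclideanSpace ℝ (Fin N), 0 < x i0 → divW N (fun z => ρ (z i0)) χ x ≤ ε)
    (hGi : IntegrableOn (fun x => G (u x)) {x | 0 < x i0}) :
    ∫ x in {x | 0 < x i0}, χ x * (G2 (u x) * (ρ (x i0) * ‖gradient u x‖^2))
      ≤ (∫ x in {x | 0 < x i0}, χ x * (G1 (u x) * (- divW N (fun z => ρ (z i0)) u x)))
        + ε * ∫ x in {x | 0 < x i0}, G (u x) := by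
  have hcG1 : ContDiff ℝ 1 G1 := by
    rw [contDiff_one_iff_deriv]
    refine ⟨fun s => (hG1 s).differentiableAt, ?_⟩
    have : deriv G1 = G2 := funext fun s => (hG1 s).deriv
    rw [this]; exact hG2c
  have hcG : ContDiff ℝ 1 G := by
    rw [contDiff_one_iff_deriv]
    refine ⟨fun s => (hG s).differentiableAt, ?_⟩
    have : deriv G = G1 := funext fun s => (hG s).deriv
    rw [this]; exact hcG1.continuous
  have hu1 : ContDiff ℝ 1 u := hu.of_le (by norm_num)
  have hχ1 : ContDiff ℝ 1 χ := hχ.of_le (by norm_num)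
  have hρd : ContDiff ℝ 1 (fun z : EuclideanSpace ℝ (Fin N) => ρ (z i0)) :=
    hρ.comp (by fun_prop)
  have hA : ∀ i, ContDiff ℝ 1 (fun z => ρ (z i0) * pd N u i z) := fun i =>
    hρd.mul (pd_contDiff hu i)
  have hB : ∀ i, ContDiff ℝ 1 (fun z => ρ (z i0) * pd N χ i z) := fun i =>
    hρd.mul (pd_contDiff hχ i)
  set V : Fin N → EuclideanSpace ℝ (Fin N) → ℝ := fun i z =>
    (χ z * G1 (u z)) * (ρ (z i0) * pd N u i z) - G (u z) * (ρ (z i0) * pd N χ i z) with hV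
  have hVc : ∀ i, ContDiff ℝ 1 (V i) := fun i =>
    ((hχ1.mul (hcG1.comp hu1)).mul (hA i)).sub ((hcG.comp hu1).mul (hB i))
  have hVs : ∀ i, HasCompactSupport (V i) := by
    intro i
    have h1 : HasCompactSupport (fun z => (χ z * G1 (u z)) * (ρ (z i0) * pd N u i z)) :=
      (hχs.mul_right).mul_right
    have h2 : HasCompactSupport (fun z => G (u z) * (ρ (z i0) * pd N χ i z)) :=
      ((pd_supp hχs i).mul_left).mul_left
    exact h1.sub h2
  have key := aux_div N i0 V hVc hVs (by
    intro x hx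
    simp only [hV, hχb x hx, hx]
    have := hub x hx
    have h1 := hG1n (u x)
    have h2 := hχ0 x
    have : 0 ≤ χ x * G1 (u x) * (ρ 0 * pd N u i0 x) := by positivity
    linarith)
  have hpt := aux_ptwise N i0 ρ hρ u χ hu hχ G G1 G2 hG hG1
  have hVi : Integrable (fun x => ∑ i, pd N (V i) i x) := by
    refine integrable_finsetSum _ fun i _ => ?_
    exact (pd_cont (hVc i) i).integrable_of_hasCompactSupport (pd_supp (hVs i) i)
  have hgc : Continuous (fun x => ‖gradient u x‖) := by
    simp_rw [grad_norm]
    exact (hu1.continuous_fderiv (by norm_num)).norm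
  have hdc : Continuous (fun x => divW N (fun z => ρ (z i0)) u x) := by
    unfold divW
    exact continuous_finsetSum _ fun i _ => pd_cont (hA i) i
  have i1 : Integrable (fun x => χ x * (G2 (u x) * (ρ (x i0) * ‖gradient u x‖^2))) := by
    refine Continuous.integrable_of_hasCompactSupport ?_ hχs.mul_right
    exact hχ1.continuous.mul ((hG2c.comp hu1.continuous).mul (hρd.continuous.mul (hgc.pow 2)))
  have i2 : Integrable (fun x => χ x * (G1 (u x) * (- divW N (fun z => ρ (z i0)) u x))) := by
    refine Continuous.integrable_of_hasCompactSupport ?_ hχs.mul_right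
    exact hχ1.continuous.mul ((hcG1.continuous.comp hu1.continuous).mul hdc.neg)
  have hms : MeasurableSet {x : EuclideanSpace ℝ (Fin N) | 0 < x i0} :=
    (isOpen_lt continuous_const (by fun_prop)).measurableSet
  have h3 : ∫ x in {x | 0 < x i0}, (χ x * (G2 (u x) * (ρ (x i0) * ‖gradient u x‖^2))
      - χ x * (G1 (u x) * (- divW N (fun z => ρ (z i0)) u x)) - ε * G (u x))
      ≤ ∫ x in {x | 0 < x i0}, ∑ i, pd N (V i) i x := by
    refine setIntegral_mono_on ?_ hVi.integrableOn hms ?_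
    · exact (i1.integrableOn.sub i2.integrableOn).sub (hGi.const_mul ε)
    · intro x hx
      rw [hpt x]
      have := mul_le_mul_of_nonneg_left (hχε x hx) (hGn (u x))
      linarith
  rw [integral_sub, integral_sub, integral_const_mul] at h3
  · linarith
  · exact i1.integrableOn
  · exact i2.integrableOn
  · exact i1.integrableOn.sub i2.integrableOn
  · exact hGi.const_mul ε

lemma aux_en (N : ℕ) (i0 : Fin N) (ρ : ℝ → ℝ) (hρ : ContDiff ℝ 1 ρ)
    (hρ1 : ∀ s, 0 ≤ s → 1 ≤ ρ s)
    (u : EuclideanSpace ℝ (Fin N) → ℝ) (hu : ContDiff ℝ 2 u)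
    (hub : ∀ x : EuclideanSpace ℝ (Fin N), x i0 = 0 → 0 ≤ pd N u i0 x)
    (G G1 G2 : ℝ → ℝ) (hG : ∀ s, HasDerivAt G (G1 s) s) (hG1 : ∀ s, HasDerivAt G1 (G2 s) s)
    (hG2c : Continuous G2) (hG1n : ∀ s, 0 ≤ G1 s) (hGn : ∀ s, 0 ≤ G s)
    (hGi : IntegrableOn (fun x => G (u x)) {x | 0 < x i0})
    (hEi : IntegrableOn (fun x => G2 (u x) * (ρ (x i0) * ‖gradient u x‖^2)) {x | 0 < x i0})
    (hFi : IntegrableOn (fun x => G1 (u x) * (- divW N (fun z => ρ (z i0)) u x)) {x | 0 < x i0}) :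
    ∫ x in {x | 0 < x i0}, G2 (u x) * (ρ (x i0) * ‖gradient u x‖^2)
      ≤ ∫ x in {x | 0 < x i0}, G1 (u x) * (- divW N (fun z => ρ (z i0)) u x) := by
  have hms : MeasurableSet {x : EuclideanSpace ℝ (Fin N) | 0 < x i0} :=
    (isOpen_lt continuous_const (by fun_prop)).measurableSet
  choose χ χc χs χ0 χ1 χone χb χε using fun n : ℕ =>
    aux_cutoff N i0 ρ hρ hρ1 (1 / ((n:ℝ) + 1)) ((n:ℝ) + 1) (by positivity) (by positivity)
  have hlim : ∀ f : EuclideanSpace ℝ (Fin N) → ℝ, IntegrableOn f {x | 0 < x i0} →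
      Tendsto (fun n => ∫ x in {x | 0 < x i0}, χ n x * f x) atTop
        (𝓝 (∫ x in {x | 0 < x i0}, f x)) := by
    intro f hf
    refine tendsto_integral_of_dominated_convergence (fun x => ‖f x‖) ?_ hf.norm ?_ ?_
    · intro n
      exact ((χc n).continuous.aestronglyMeasurable).mul hf.aestronglyMeasurable
    · intro n
      filter_upwards with x
      rw [norm_mul, Real.norm_eq_abs, abs_of_nonneg (χ0 n x)]
      exact mul_le_of_le_one_left (norm_nonneg _) (χ1 n x)
    · rw [ae_restrict_iff' hms]
      filter_upwards with x hx
      refine tendsto_const_nhds.congr' ?_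
      obtain ⟨n0, hn0⟩ := exists_nat_ge ‖x‖
      filter_upwards [eventually_ge_atTop n0] with n hn
      have : (n0:ℝ) ≤ n := by exact_mod_cast hn
      rw [χone n x (le_of_lt hx) (by linarith), one_mul]
  have h1 := hlim _ hEi
  have h2 := (hlim _ hFi).add
    ((tendsto_one_div_add_atTop_nhds_zero_nat (𝕜 := ℝ)).mul_const (∫ x in {x | 0 < x i0}, G (u x)))
  rw [zero_mul, add_zero] at h2
  refine le_of_tendsto_of_tendsto' h1 h2 fun n => ?_
  exact aux_en0 N i0 ρ hρ (by linarith [hρ1 0 le_rfl]) u (χ n) hu (χc n) hub G G1 G2 hG hG1 hG2c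
    hG1n hGn _ (χs n) (χ0 n) (χb n) (χε n) hGi

lemma aux_pt1 (k p s : ℝ) (hk : 0 < k) (hp : 2 < p) (hs : 0 ≤ s) :
    (max (s - k) 0)^2 ≤ k^(2-p) * s^p := by
  rcases le_or_gt s k with h | h
  · rw [max_eq_right (by linarith)]
    have : 0 ≤ k^(2-p) * s^p := by positivity
    simpa using this
  · have hs0 : 0 < s := by linarith
    rw [max_eq_left (by linarith)]
    have h1 : s^(2-p) ≤ k^(2-p) := Real.rpow_le_rpow_of_nonpos hk h.le (by linarith)
    have h2 : s^(2-p) * s^p = s^2 := by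
      rw [← Real.rpow_add hs0, ← Real.rpow_natCast]
      congr 1; push_cast; ring
    calc (s-k)^2 ≤ s^2 := by nlinarith
      _ = s^(2-p) * s^p := h2.symm
      _ ≤ _ := by gcongr

lemma aux_pt2 (p s : ℝ) (hs : 0 ≤ s) (hp : 2 < p) : s * (|s|^(p-2) * s) = s^p := by
  rcases hs.eq_or_lt with h | h
  · rw [← h, Real.zero_rpow (by linarith)]; simp
  · rw [abs_of_pos h]
    have h2 : s^(p-2) * s^(2:ℝ) = s^p := by
      rw [← Real.rpow_add h]; congr 1; ring
    rw [← h2]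
    norm_num
    ring

lemma aux_pt3 (L c d p s t : ℝ) (hc : 0 < c) (hcd : c < d) (hL : c + d ≤ L * (d - c)) (hp : 2 < p)
    (hs : 0 ≤ s) (ht : t ≤ max (s - (c+d)/2) 0) :
    t * (|s|^(p-2) * s) ≤ L^p * (max (s - c) 0)^p := by
  have hL1 : 1 ≤ L := by
    by_contra h
    push Not at h
    nlinarith
  have hq : 0 ≤ |s|^(p-2) * s := by positivity
  have hR : 0 ≤ L^p * (max (s - c) 0)^p := by positivity
  rcases le_or_gt s ((c+d)/2) with h | h
  · rw [max_eq_right (by linarith)] at ht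
    exact (mul_nonpos_of_nonpos_of_nonneg ht hq).trans hR
  · rw [max_eq_left (by linarith)] at ht
    have h1 : t ≤ s := by linarith
    refine (mul_le_mul_of_nonneg_right h1 hq).trans ?_
    rw [aux_pt2 p s hs hp, max_eq_left (by linarith), ← Real.mul_rpow (by linarith) (by linarith)]
    refine Real.rpow_le_rpow hs ?_ (by linarith)
    nlinarith

lemma aux_step (N : ℕ) (hN : 3 ≤ N) (i0 : Fin N) (ρ : ℝ → ℝ) (hρ : ContDiff ℝ 1 ρ)
    (hρ1 : ∀ s, 0 ≤ s → 1 ≤ ρ s) (a p : ℝ) (ha : 0 < a) (hp : p = 2 * (N : ℝ) / ((N : ℝ) - 2))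
    (u : EuclideanSpace ℝ (Fin N) → ℝ) (hu : ContDiff ℝ 2 u)
    (hub : ∀ x : EuclideanSpace ℝ (Fin N), x i0 = 0 → 0 ≤ pd N u i0 x)
    (hsol : ∀ x : EuclideanSpace ℝ (Fin N), 0 < x i0 →
      -divW N (fun z => ρ (z i0)) u x = a * |u x| ^ (p - 2) * u x)
    (hpos : ∀ x : EuclideanSpace ℝ (Fin N), 0 < x i0 → 0 ≤ u x)
    (henergy : IntegrableOn (fun x => ρ (x i0) * ‖gradient u x‖ ^ 2) {x | 0 < x i0})
    (hLp : IntegrableOn (fun x => |u x| ^ p) {x | 0 < x i0})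
    (S : ℝ) (hS : 0 < S)
    (hSob : ∀ w : EuclideanSpace ℝ (Fin N) → ℝ, ContDiff ℝ 1 w →
      IntegrableOn (fun x => |w x|^(2*(N:ℝ)/((N:ℝ)-2))) {x | 0 < x i0} →
      IntegrableOn (fun x => (w x)^2) {x | 0 < x i0} →
      IntegrableOn (fun x => ‖fderiv ℝ w x‖^2) {x | 0 < x i0} →
      ∫ x in {x | 0 < x i0}, |w x|^(2*(N:ℝ)/((N:ℝ)-2)) ≤
        (S * ∫ x in {x | 0 < x i0}, ‖fderiv ℝ w x‖^2)^((2*(N:ℝ)/((N:ℝ)-2))/2))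
    (L c d : ℝ) (hc : 0 < c) (hcd : c < d) (hL : c + d ≤ L * (d - c)) :
    ∫ x in {x | 0 < x i0}, (max (u x - d) 0)^p ≤
      (S * a * L^p * ∫ x in {x | 0 < x i0}, (max (u x - c) 0)^p)^(p/2) := by
  rw [← hp] at hSob
  have hms : MeasurableSet {x : EuclideanSpace ℝ (Fin N) | 0 < x i0} :=
    (isOpen_lt continuous_const (by fun_prop)).measurableSet
  have hp2 : 2 < p := by
    have : (3:ℝ) ≤ N := by exact_mod_cast hN
    rw [hp, lt_div_iff₀ (by linarith)]; linarith
  have hu1 : ContDiff ℝ 1 u := hu.of_le (by norm_num)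
  have huc := hu1.continuous
  have hLp' : IntegrableOn (fun x => (u x)^p) {x | 0 < x i0} := by
    refine hLp.congr_fun (fun x hx => ?_) hms
    simp only [abs_of_nonneg (hpos x hx)]
  have hgc : Continuous (fun x => ‖gradient u x‖) := by
    simp_rw [grad_norm]
    exact (hu1.continuous_fderiv (by norm_num)).norm
  have hρc : Continuous (fun x : EuclideanSpace ℝ (Fin N) => ρ (x i0)) :=
    hρ.continuous.comp (by fun_prop)
  -- bounded by u
  have hmaxc : ∀ t, Continuous (fun x => (max (u x - t) 0)^p) := fun t =>
    ((huc.sub continuous_const).max continuous_const).rpow_const (fun _ => Or.inr (by linarith))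
  have hmaxi : ∀ t, 0 < t → IntegrableOn (fun x => (max (u x - t) 0)^p) {x | 0 < x i0} := by
    intro t ht
    refine Integrable.mono' hLp' (hmaxc t).aestronglyMeasurable ?_
    rw [ae_restrict_iff' hms]
    filter_upwards with x hx
    have h0 := hpos x hx
    rw [Real.norm_eq_abs, abs_of_nonneg (by positivity)]
    exact Real.rpow_le_rpow (by positivity) (max_le (by linarith) h0) (by linarith)
  obtain ⟨g, h, G, G1, G2, hg, hh, hG, hG1, hG2c, hG20, hG21, hhG, hG10, hG1m, hG0, hGm, hg0, hgm, hgd⟩ :=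
    aux_gG ((c+d)/2) ((d-c)/2) (by linarith)
  have hk0 : 0 < (c+d)/2 := by linarith
  have hsq : IntegrableOn (fun x => (max (u x - (c+d)/2) 0)^2) {x | 0 < x i0} := by
    refine Integrable.mono' (hLp'.const_mul (((c+d)/2)^(2-p)))
      (((huc.sub continuous_const).max continuous_const).pow 2).aestronglyMeasurable ?_
    rw [ae_restrict_iff' hms]
    filter_upwards with x hx
    rw [Real.norm_eq_abs, abs_of_nonneg (by positivity)]
    exact aux_pt1 _ _ _ hk0 hp2 (hpos x hx)
  have hGc : Continuous G := continuous_iff_continuousAt.2 fun s => (hG s).continuousAt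
  have hG1c : Continuous G1 := continuous_iff_continuousAt.2 fun s => (hG1 s).continuousAt
  have hgcont : Continuous g := continuous_iff_continuousAt.2 fun s => (hg s).continuousAt
  have hGi : IntegrableOn (fun x => G (u x)) {x | 0 < x i0} := by
    refine Integrable.mono' hsq (hGc.comp huc).aestronglyMeasurable ?_
    filter_upwards with x
    rw [Real.norm_eq_abs, abs_of_nonneg (hG0 _)]
    exact hGm _
  have hEi : IntegrableOn (fun x => G2 (u x) * (ρ (x i0) * ‖gradient u x‖^2)) {x | 0 < x i0} := by
    refine Integrable.mono' henergy
      ((hG2c.comp huc).mul (hρc.mul (hgc.pow 2))).aestronglyMeasurable ?_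
    rw [ae_restrict_iff' hms]
    filter_upwards with x hx
    have h1 := hρ1 _ (le_of_lt hx)
    have h2 : 0 ≤ ρ (x i0) * ‖gradient u x‖^2 := by positivity
    rw [Real.norm_eq_abs, abs_of_nonneg (mul_nonneg (hG20 _) h2)]
    exact mul_le_of_le_one_left h2 (hG21 _)
  have hF' : IntegrableOn (fun x => a * (G1 (u x) * (|u x|^(p-2) * u x))) {x | 0 < x i0} := by
    refine Integrable.const_mul ?_ a
    refine Integrable.mono' ((hmaxi c hc).const_mul (L^p)) ?_ ?_
    · refine ((hG1c.comp huc).mul ((huc.abs.rpow_const (fun _ => Or.inr (by linarith))).mul huc)).aestronglyMeasurable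
    · rw [ae_restrict_iff' hms]
      filter_upwards with x hx
      have h1 := hpos x hx
      have h2 := hG10 (u x)
      rw [Real.norm_eq_abs, abs_of_nonneg (by positivity)]
      exact aux_pt3 L c d p (u x) _ hc hcd hL hp2 h1 (hG1m _)
  have hEq : Set.EqOn (fun x => a * (G1 (u x) * (|u x|^(p-2) * u x)))
      (fun x => G1 (u x) * (- divW N (fun z => ρ (z i0)) u x)) {x | 0 < x i0} := by
    intro x hx
    simp only
    rw [hsol x hx]; ring
  have hFi : IntegrableOn (fun x => G1 (u x) * (- divW N (fun z => ρ (z i0)) u x)) {x | 0 < x i0} :=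
    hF'.congr_fun hEq hms
  have key := aux_en N i0 ρ hρ hρ1 u hu hub G G1 G2 hG hG1 hG2c hG10 hG0 hGi hEi hFi
  rw [← setIntegral_congr_fun hms hEq, integral_const_mul] at key
  have hFb : ∫ x in {x | 0 < x i0}, G1 (u x) * (|u x|^(p-2) * u x) ≤
      L^p * ∫ x in {x | 0 < x i0}, (max (u x - c) 0)^p := by
    rw [← integral_const_mul]
    refine setIntegral_mono_on ?_ ((hmaxi c hc).const_mul (L^p)) hms ?_
    · have := hF'.const_mul a⁻¹
      refine this.congr ?_
      filter_upwards with x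
      field_simp
    · intro x hx
      exact aux_pt3 L c d p (u x) _ hc hcd hL hp2 (hpos x hx) (hG1m _)
  -- the function w
  have hgC : ContDiff ℝ 1 g := by
    rw [contDiff_one_iff_deriv]
    refine ⟨fun s => (hg s).differentiableAt, ?_⟩
    have : deriv g = h := funext fun s => (hg s).deriv
    rw [this]; exact hh
  have hwC : ContDiff ℝ 1 (fun x => g (u x)) := hgC.comp hu1
  have hwf : ∀ x, ‖fderiv ℝ (fun x => g (u x)) x‖^2 = (h (u x))^2 * ‖gradient u x‖^2 := by
    intro x
    have h4 : fderiv ℝ (fun z => g (u z)) x = _ :=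
      (HasDerivAt.comp_hasFDerivAt (h₂ := g) x (hg (u x))
        (hu1.differentiable (by norm_num) x).hasFDerivAt).fderiv
    rw [h4, norm_smul, grad_norm, mul_pow, Real.norm_eq_abs, sq_abs]
  have hwle : ∀ x ∈ {x : EuclideanSpace ℝ (Fin N) | 0 < x i0},
      ‖fderiv ℝ (fun x => g (u x)) x‖^2 ≤ G2 (u x) * (ρ (x i0) * ‖gradient u x‖^2) := by
    intro x hx
    rw [hwf]
    have h1 := hρ1 _ (le_of_lt hx)
    have h2 : ‖gradient u x‖^2 ≤ ρ (x i0) * ‖gradient u x‖^2 :=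
      le_mul_of_one_le_left (by positivity) h1
    exact mul_le_mul (hhG _) h2 (by positivity) (hG20 _)
  have hwi : IntegrableOn (fun x => ‖fderiv ℝ (fun x => g (u x)) x‖^2) {x | 0 < x i0} := by
    refine Integrable.mono' hEi
      (((hwC.continuous_fderiv (by norm_num)).norm.pow 2).aestronglyMeasurable) ?_
    rw [ae_restrict_iff' hms]
    filter_upwards with x hx
    rw [Real.norm_eq_abs, abs_of_nonneg (by positivity)]
    exact hwle x hx
  have hwp : IntegrableOn (fun x => |g (u x)|^p) {x | 0 < x i0} := by
    refine Integrable.mono' (hmaxi _ hk0)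
      ((hgcont.comp huc).abs.rpow_const (fun _ => Or.inr (by linarith))).aestronglyMeasurable ?_
    filter_upwards with x
    rw [Real.norm_eq_abs, abs_of_nonneg (by positivity), abs_of_nonneg (hg0 _)]
    exact Real.rpow_le_rpow (hg0 _) (hgm _) (by linarith)
  have hw2 : IntegrableOn (fun x => (g (u x))^2) {x | 0 < x i0} := by
    refine Integrable.mono' hsq ((hgcont.comp huc).pow 2).aestronglyMeasurable ?_
    filter_upwards with x
    rw [Real.norm_eq_abs, abs_of_nonneg (by positivity)]
    exact pow_le_pow_left₀ (hg0 _) (hgm _) 2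
  have sob := hSob _ hwC hwp hw2 hwi
  have h1 : ∫ x in {x | 0 < x i0}, (max (u x - d) 0)^p ≤ ∫ x in {x | 0 < x i0}, |g (u x)|^p := by
    refine setIntegral_mono_on (hmaxi d (by linarith)) hwp hms ?_
    intro x hx
    rw [abs_of_nonneg (hg0 _)]
    refine Real.rpow_le_rpow (le_max_right _ _) ?_ (by linarith)
    have := hgd (u x)
    rwa [show (c+d)/2 + (d-c)/2 = d by ring] at this
  have h2 : ∫ x in {x | 0 < x i0}, ‖fderiv ℝ (fun x => g (u x)) x‖^2 ≤
      ∫ x in {x | 0 < x i0}, G2 (u x) * (ρ (x i0) * ‖gradient u x‖^2) :=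
    setIntegral_mono_on hwi hEi hms hwle
  refine (h1.trans sob).trans (Real.rpow_le_rpow ?_ ?_ (by linarith))
  · refine mul_nonneg hS.le (integral_nonneg fun x => by positivity)
  · calc S * _ ≤ S * (a * (L^p * ∫ x in {x | 0 < x i0}, (max (u x - c) 0)^p)) := by
          refine mul_le_mul_of_nonneg_left ?_ hS.le
          exact (h2.trans key).trans (mul_le_mul_of_nonneg_left hFb ha.le)
      _ = _ := by ring

lemma aux_bdd (N : ℕ) (i0 : Fin N) (A B p : ℝ) (hA : 0 < A) (hB : 1 < B) (hp2 : 2 < p)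
    (u : EuclideanSpace ℝ (Fin N) → ℝ) (huc : Continuous u)
    (hpos : ∀ x : EuclideanSpace ℝ (Fin N), 0 < x i0 → 0 ≤ u x)
    (hLp : IntegrableOn (fun x => |u x| ^ p) {x | 0 < x i0})
    (hstep : ∀ K : ℝ, 0 < K → ∀ j : ℕ,
      ∫ x in {x | 0 < x i0}, (max (u x - K * (2 - (1/2)^(j+1))) 0)^p ≤
      (A * B^j * ∫ x in {x | 0 < x i0}, (max (u x - K * (2 - (1/2)^j)) 0)^p)^(p/2)) :
    ∃ M : ℝ, ∀ x : EuclideanSpace ℝ (Fin N), 0 ≤ x i0 → u x ≤ M := by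
  have hop : IsOpen {x : EuclideanSpace ℝ (Fin N) | 0 < x i0} :=
    isOpen_lt continuous_const (by fun_prop)
  have hms := hop.measurableSet
  have hLp' : IntegrableOn (fun x => (u x)^p) {x | 0 < x i0} := by
    refine hLp.congr_fun (fun x hx => ?_) hms
    simp only [abs_of_nonneg (hpos x hx)]
  have hmaxc : ∀ t, Continuous (fun x => (max (u x - t) 0)^p) := fun t =>
    ((huc.sub continuous_const).max continuous_const).rpow_const (fun _ => Or.inr (by linarith))
  have hle : ∀ t, 0 ≤ t → ∀ x ∈ {x : EuclideanSpace ℝ (Fin N) | 0 < x i0},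
      ‖(max (u x - t) 0)^p‖ ≤ (u x)^p := by
    intro t ht x hx
    have h0 := hpos x hx
    rw [Real.norm_eq_abs, abs_of_nonneg (by positivity)]
    exact Real.rpow_le_rpow (by positivity) (max_le (by linarith) h0) (by linarith)
  have hmaxi : ∀ t, 0 ≤ t → IntegrableOn (fun x => (max (u x - t) 0)^p) {x | 0 < x i0} := by
    intro t ht
    refine Integrable.mono' hLp' (hmaxc t).aestronglyMeasurable ?_
    rw [ae_restrict_iff' hms]
    filter_upwards with x hx using hle t ht x hx
  obtain ⟨ε, hε, hit⟩ := aux_iter A B (p/2) hA hB (by linarith)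
  have hT : Tendsto (fun n : ℕ => ∫ x in {x | 0 < x i0}, (max (u x - (n:ℝ)) 0)^p) atTop
      (𝓝 (∫ x in {x : EuclideanSpace ℝ (Fin N) | 0 < x i0}, (0:ℝ))) := by
    refine tendsto_integral_of_dominated_convergence (fun x => (u x)^p)
      (fun n => (hmaxc n).aestronglyMeasurable) hLp' ?_ ?_
    · intro n
      rw [ae_restrict_iff' hms]
      filter_upwards with x hx using hle n (by positivity) x hx
    · filter_upwards with x
      refine tendsto_const_nhds.congr' ?_
      obtain ⟨n0, hn0⟩ := exists_nat_ge (u x)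
      filter_upwards [eventually_ge_atTop n0] with n hn
      have : (n0:ℝ) ≤ n := by exact_mod_cast hn
      rw [max_eq_right (by linarith), Real.zero_rpow (by linarith)]
  rw [integral_zero] at hT
  obtain ⟨n, hn1, hn2⟩ := ((hT.eventually (gt_mem_nhds hε)).and (eventually_ge_atTop 1)).exists
  set K : ℝ := (n:ℝ) with hK
  have hK0 : 0 < K := by rw [hK]; exact_mod_cast hn2
  have hY := hit (fun j => ∫ x in {x | 0 < x i0}, (max (u x - K * (2 - (1/2)^j)) 0)^p)
    (fun j => integral_nonneg fun x => by positivity)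
    (by simp only [pow_zero]; norm_num; exact hn1.le) (hstep K hK0)
  have hz : ∫ x in {x | 0 < x i0}, (max (u x - K * 2) 0)^p ≤ 0 := by
    refine ge_of_tendsto' hY fun j => ?_
    have hj : (0:ℝ) < (1/2)^j := by positivity
    have hj1 : ((1:ℝ)/2)^j ≤ 1 := pow_le_one₀ (by norm_num) (by norm_num)
    refine setIntegral_mono_on (hmaxi _ (by positivity)) (hmaxi _ (by nlinarith)) hms ?_
    intro x hx
    refine Real.rpow_le_rpow (le_max_right _ _) (max_le_max ?_ le_rfl) (by linarith)
    nlinarith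
  have hz0 : ∫ x in {x | 0 < x i0}, (max (u x - K * 2) 0)^p = 0 :=
    le_antisymm hz (integral_nonneg fun x => by positivity)
  rw [integral_eq_zero_iff_of_nonneg (fun x => by positivity) (hmaxi _ (by positivity))] at hz0
  have hEq := MeasureTheory.Measure.eqOn_open_of_ae_eq hz0 hop (hmaxc _).continuousOn
    continuousOn_const
  have hHle : ∀ x : EuclideanSpace ℝ (Fin N), 0 < x i0 → u x ≤ K * 2 := by
    intro x hx
    have h1 := hEq hx
    simp only [Pi.zero_apply] at h1
    by_contra h2
    push Not at h2
    rw [max_eq_left (by linarith)] at h1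
    exact (Real.rpow_pos_of_pos (by linarith : 0 < u x - K * 2) p).ne' h1
  refine ⟨K * 2, fun x hx => ?_⟩
  have ht : Tendsto (fun n : ℕ => u (x + (1 / ((n:ℝ) + 1)) • EuclideanSpace.single i0 (1:ℝ))) atTop
      (𝓝 (u (x + (0:ℝ) • EuclideanSpace.single i0 (1:ℝ)))) :=
    (huc.tendsto _).comp (tendsto_const_nhds.add
      ((tendsto_one_div_add_atTop_nhds_zero_nat (𝕜 := ℝ)).smul_const _))
  rw [zero_smul, add_zero] at ht
  refine le_of_tendsto' ht fun n => hHle _ ?_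
  have : (0:ℝ) < 1 / ((n:ℝ) + 1) := by positivity
  simp
  linarith [Nat.one_div_pos_of_nat (α := ℝ) (n := n), inv_pos.2 (by positivity : (0:ℝ) < (n:ℝ)+1)]

theorem stmt17 (N : ℕ) (hN : 3 ≤ N) (ρ : ℝ → ℝ) (hρC1 : ContDiff ℝ 1 ρ)
    (hρzero : ρ 0 = 1) (γ : ℝ) (hγ : 0 ≤ γ)
    (hρlow : ∀ s : ℝ, 0 ≤ s → (1 + s) ^ γ ≤ ρ s)
    (a b q : ℝ) (ha : 0 < a) (hb : b ≤ 0) (hq : 1 < q)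
    (u : EuclideanSpace ℝ (Fin N) → ℝ) (hu : ContDiff ℝ 2 u)
    (hsol : IsSolutionP0 N (by omega) ρ a b (2 * (N : ℝ) / ((N : ℝ) - 2)) q u)
    (hpos : ∀ x, 0 ≤ xN N (by omega) x → 0 ≤ u x)
    (henergy : IntegrableOn (fun x => ρ (xN N (by omega) x) * ‖gradient u x‖ ^ 2)
      (Hplus N (by omega)) volume)
    (hLp : IntegrableOn (fun x => |u x| ^ (2 * (N : ℝ) / ((N : ℝ) - 2)))
      (Hplus N (by omega)) volume)
    (hL2 : Integrable (fun y : EuclideanSpace ℝ (Fin (N - 1)) => (u (bPt N y)) ^ 2))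
    (hLq : Integrable (fun y : EuclideanSpace ℝ (Fin (N - 1)) => |u (bPt N y)| ^ q)) :
    ∃ M : ℝ, ∀ x, 0 ≤ xN N (by omega) x → u x ≤ M := by
  have hN0 : 0 < N := by omega
  obtain ⟨hs1, hs2⟩ := hsol
  set i0 : Fin N := ⟨N - 1, Nat.sub_lt hN0 Nat.one_pos⟩ with hi0
  have hρ1 : ∀ s, 0 ≤ s → 1 ≤ ρ s := fun s hs =>
    (Real.one_le_rpow (by linarith) hγ).trans (hρlow s hs)
  have hN3 : (3:ℝ) ≤ N := by exact_mod_cast hN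
  have hp2 : 2 < 2 * (N : ℝ) / ((N : ℝ) - 2) := by
    rw [lt_div_iff₀ (by linarith)]; linarith
  have hpos' : ∀ x : EuclideanSpace ℝ (Fin N), 0 < x i0 → 0 ≤ u x := fun x hx => hpos x hx.le
  have hub : ∀ x : EuclideanSpace ℝ (Fin N), x i0 = 0 → 0 ≤ pd N u i0 x := by
    intro x hx
    set y : EuclideanSpace ℝ (Fin (N-1)) :=
      WithLp.toLp 2 (fun i => x ⟨(i:ℕ), by omega⟩) with hy
    have hxy : bPt N y = x := by
      ext i
      simp only [bPt, mkPt, hy, WithLp.equiv_symm_apply]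
      split_ifs with h
      · rfl
      · have : i = i0 := by
          apply Fin.ext
          simp only [hi0]
          omega
        rw [this, hx]
    have h1 := hs2 y
    rw [hxy] at h1
    have h2 : 0 ≤ u x := hpos x (le_of_eq hx.symm)
    have h3 : 0 ≤ |u x|^(q-2) * u x := by positivity
    have h4 : b * |u x| ^ (q - 2) * u x ≤ 0 := by
      rw [mul_assoc]; exact mul_nonpos_of_nonpos_of_nonneg hb h3
    linarith
  obtain ⟨S, hS, hSob⟩ := aux_sob2 N hN i0
  set p : ℝ := 2 * (N : ℝ) / ((N : ℝ) - 2) with hp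
  have h2p : (1:ℝ) < 2^p := Real.one_lt_rpow (by norm_num) (by linarith)
  refine aux_bdd N i0 (S * a * (2^p)^3) (2^p) p (by positivity) h2p hp2 u hu.continuous hpos' hLp ?_
  intro K hK j
  have hj : (0:ℝ) < (1/2)^j := by positivity
  have hj1 : ((1:ℝ)/2)^j ≤ 1 := pow_le_one₀ (by norm_num) (by norm_num)
  have hj2 : (2:ℝ)^j * (1/2)^j = 1 := by rw [← mul_pow]; norm_num
  have := aux_step N hN i0 ρ hρC1 hρ1 a p ha hp u hu hub hs1 hpos' henergy hLp S hS hSob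
    (2^(j+3)) (K * (2 - (1/2)^j)) (K * (2 - (1/2)^(j+1)))
    (mul_pos hK (by linarith)) (by rw [pow_succ]; nlinarith) (by
      rw [pow_succ, pow_add]
      have : (2:ℝ)^j * 2^3 * (K * (2 - (1/2)^j * (1/2)) - K * (2 - (1/2)^j))
        = 4 * K * (2^j * (1/2)^j) := by ring
      rw [this, hj2]
      nlinarith)
  have hB : ((2:ℝ)^(j+3))^p = (2^p)^3 * (2^p)^j := by
    rw [← Real.rpow_natCast, ← Real.rpow_mul (by norm_num), mul_comm, Real.rpow_mul (by norm_num),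
      Real.rpow_natCast, pow_add, mul_comm]
  rw [hB] at this
  refine this.trans (le_of_eq ?_)
  congr 1
  ring
end
end

section
/- Let $N\ge3$ and let $\rho\in C^1([0,\infty))$ satisfy $\rho(0)=1$ and condition $(\rho_0)$ with some exponent $\gamma>1$. Let $a\le0$, $b>0$, $p\in(1,\infty)$, $q\in[2,2_*]$, $M>0$ and $1<\delta<2$. Then there exist $\theta_0>3$ and a constant $C>0$, depending only on $N$, $M$, $b$, $q$ and $\sup_{s\in[0,3]}\rho(s)$, such that every classical solution $u$ of problem $(\mathcal{P}_0)$ satisfying $0<u(x)\le M$ for all $x\in B_{3\delta}^+:=\{x\in\overline{\mathbb{R}^N_+}:|x|<3\delta\}$ obeys $\max_{\overline{B_1^+}}u+\max_{\overline{\Gamma_1}}u\le C\left(\int_{B_2^+}u^{\theta_0}\,dx+\int_{\Gamma_2}u(x',0)^{\theta_0}\,dx'\right)^{1/\theta_0}$, where $B_r^+=\{x\in\mathbb{R}^N_+:|x|<r\}$ and $\Gamma_r=\{x'\in\mathbb{R}^{N-1}:|x'|<r\}$. -/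
open MeasureTheory Filter
open scoped Topology ENNReal

noncomputable section

section Helpers

/-- coordinate derivative on the product space -/
def Dc {N : ℕ} (i : Fin N) (f : (Fin N → ℝ) → ℝ) (x : Fin N → ℝ) : ℝ :=
  fderiv ℝ f x (Pi.single i 1)

/-- half line in direction `l`, whole line otherwise -/
def Sset {N : ℕ} (l i : Fin N) : Set ℝ := if i = l then Set.Ioi 0 else Set.univ

/-- Lebesgue measure on the half space -/
def nuH {N : ℕ} (l : Fin N) : Measure (Fin N → ℝ) :=
  Measure.pi (fun i => (volume : Measure ℝ).restrict (Sset l i))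

lemma nuH_eq {N : ℕ} (l : Fin N) :
    nuH l = (volume : Measure (Fin N → ℝ)).restrict {x | 0 < x l} := by
  unfold nuH
  rw [← Measure.restrict_pi_pi, ← volume_pi]
  congr 1
  ext x
  simp only [Set.mem_pi, Set.mem_univ, forall_const, Set.mem_ofPred_eq, Sset]
  constructor
  · intro h; simpa using h l
  · intro h i
    by_cases hi : i = l
    · subst hi; simpa using h
    · simp [hi]

lemma Dc_hasDerivAt {N : ℕ} (i : Fin N) {f : (Fin N → ℝ) → ℝ} (hf : ContDiff ℝ 1 f)
    (x : Fin N → ℝ) (t : ℝ) :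
    HasDerivAt (fun s => f (Function.update x i s)) (Dc i f (Function.update x i t)) t := by
  have h1 := (hf.differentiable one_ne_zero (Function.update x i t)).hasFDerivAt
  exact h1.comp_hasDerivAt t (hasDerivAt_update x i t)

lemma Dc_continuous {N : ℕ} (i : Fin N) {f : (Fin N → ℝ) → ℝ} (hf : ContDiff ℝ 1 f) :
    Continuous (Dc i f) := by
  unfold Dc
  exact (hf.continuous_fderiv one_ne_zero).clm_apply continuous_const

lemma Dc_compact {N : ℕ} (i : Fin N) {f : (Fin N → ℝ) → ℝ} (hf : HasCompactSupport f) :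
    HasCompactSupport (Dc i f) := by
  unfold Dc
  exact (hf.fderiv (𝕜 := ℝ)).comp_left (g := fun L : (Fin N → ℝ) →L[ℝ] ℝ => L (Pi.single i 1)) rfl

lemma Dc_integrable {N : ℕ} (l i : Fin N) {f : (Fin N → ℝ) → ℝ} (hf : ContDiff ℝ 1 f)
    (h2 : HasCompactSupport f) : Integrable (Dc i f) (nuH l) := by
  rw [nuH_eq]
  exact ((Dc_continuous i hf).integrable_of_hasCompactSupport (Dc_compact i h2)).restrict

lemma update_cs {N : ℕ} (i : Fin N) {f : (Fin N → ℝ) → ℝ}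
    (h2 : HasCompactSupport f) (x : Fin N → ℝ) :
    HasCompactSupport (fun s => f (Function.update x i s)) :=
  h2.comp_isClosedEmbedding (isClosedEmbedding_update x i)

lemma update_cd {N : ℕ} (i : Fin N) {f : (Fin N → ℝ) → ℝ}
    (hf : ContDiff ℝ 1 f) (x : Fin N → ℝ) :
    ContDiff ℝ 1 (fun s => f (Function.update x i s)) :=
  hf.comp (contDiff_update 1 x i)

lemma Dc_integral_nonpos {n : ℕ} (l i : Fin (n+1)) {f : (Fin (n+1) → ℝ) → ℝ} (hf : ContDiff ℝ 1 f)
    (h2 : HasCompactSupport f) (h0 : i = l → ∀ x, x l = 0 → 0 ≤ f x) :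
    ∫ x, Dc i f x ∂(nuH l) ≤ 0 := by
  have hInt4 := Dc_integrable l i hf h2
  unfold nuH at *
  have mp := measurePreserving_piFinSuccAbove (fun i => (volume : Measure ℝ).restrict (Sset l i)) i
  have mp' := mp.symm
  rw [← mp'.integral_comp' (g := Dc i f)]
  have hInt4' := (mp'.integrable_comp_emb (MeasurableEquiv.measurableEmbedding _)).2 hInt4
  refine (integral_prod_symm _ hInt4').trans_le ?_
  apply integral_nonpos
  intro y
  simp only [Pi.zero_apply, Function.comp_apply]
  set x0 : Fin (n+1) → ℝ := i.insertNth 0 y with hx0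
  have key : ∀ t : ℝ, (MeasurableEquiv.piFinSuccAbove (fun _ : Fin (n+1) => ℝ) i).symm (t, y)
      = Function.update x0 i t := by
    intro t
    simp [hx0, MeasurableEquiv.piFinSuccAbove, Fin.insertNthEquiv]
  have hcongr : ∀ t : ℝ, Dc i f ((MeasurableEquiv.piFinSuccAbove (fun _ : Fin (n+1) => ℝ) i).symm (t, y))
      = deriv (fun s => f (Function.update x0 i s)) t := by
    intro t
    rw [key, (Dc_hasDerivAt i hf x0 t).deriv]
  simp only [hcongr]
  by_cases hi : i = l
  · simp only [Sset, hi, if_true]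
    rw [← hi, HasCompactSupport.integral_Ioi_deriv_eq (update_cd i hf x0) (update_cs i h2 x0)]
    have := h0 hi (Function.update x0 i 0) (by rw [← hi]; simp)
    linarith
  · simp only [Sset, hi, if_false, Measure.restrict_univ]
    rw [integral_of_hasDerivAt_of_tendsto (f := fun s => f (Function.update x0 i s)) (m := 0) (n := 0)
      (fun t => ((update_cd i hf x0).differentiable one_ne_zero t).hasDerivAt)
      (((update_cd i hf x0).continuous_deriv le_rfl).integrable_of_hasCompactSupport
        (update_cs i h2 x0).deriv)]
    · simp
    · have := update_cs i h2 x0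
      rw [hasCompactSupport_iff_eventuallyEq, Filter.coclosedCompact_eq_cocompact] at this
      exact (this.filter_mono _root_.atBot_le_cocompact).tendsto
    · have := update_cs i h2 x0
      rw [hasCompactSupport_iff_eventuallyEq, Filter.coclosedCompact_eq_cocompact] at this
      exact (this.filter_mono _root_.atTop_le_cocompact).tendsto

lemma enorm_le_Ioi {f : ℝ → ℝ} (hf : ContDiff ℝ 1 f) (h'f : HasCompactSupport f) (x : ℝ) :
    ‖f x‖ₑ ≤ ∫⁻ y in Set.Ioi x, ‖deriv f y‖ₑ := by
  have h := HasCompactSupport.integral_Ioi_deriv_eq hf h'f x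
  have h2 : f x = - ∫ y in Set.Ioi x, deriv f y := by rw [h]; ring
  rw [h2, enorm_neg]
  exact enorm_integral_le_lintegral_enorm _

lemma sobolev_lint {N : ℕ} (hN : 2 ≤ N) (l : Fin N) {χ : ℝ} (hχ : Real.HolderConjugate (N : ℝ) χ)
    {g : (Fin N → ℝ) → ℝ} (hg : ContDiff ℝ 1 g) (h2 : HasCompactSupport g) :
    ∫⁻ x, ‖g x‖ₑ ^ χ ∂(nuH l) ≤ (∫⁻ x, ∑ i, ‖Dc i g x‖ₑ ∂(nuH l)) ^ χ := by
  have hN1 : (1 : ℝ) ≤ (N : ℝ) - 1 := by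
    have : (2 : ℝ) ≤ N := by exact_mod_cast hN
    linarith
  have hmeas : Measurable (fun x => ∑ i, ‖Dc i g x‖ₑ) := by
    refine Finset.measurable_sum _ fun i _ => ?_
    exact (Dc_continuous i hg).measurable.enorm
  have hχ' : Real.HolderConjugate (Fintype.card (Fin N) : ℝ) χ := by simpa using hχ
  refine le_trans ?_ (lintegral_prod_lintegral_pow_le
    (fun i => (volume : Measure ℝ).restrict (Sset l i)) hχ' hmeas)
  have : ∀ x, ‖g x‖ₑ ^ χ = ∏ _i : Fin N, ‖g x‖ₑ ^ (1 / ((N:ℝ) - 1)) := by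
    intro x
    simp only [Finset.prod_const, Finset.card_univ, Fintype.card_fin]
    rw [← ENNReal.rpow_natCast, ← ENNReal.rpow_mul, hχ.conjugate_eq]
    congr 1
    field_simp
  simp only [this, Fintype.card_fin]
  change ∫⁻ x, _ ∂(nuH l) ≤ ∫⁻ x, _ ∂(nuH l)
  rw [nuH_eq]
  refine setLIntegral_mono' (measurableSet_lt measurable_const (measurable_pi_apply l)) ?_
  intro x hx
  refine Finset.prod_le_prod' fun i _ => ?_
  gcongr
  have hD : ∀ t, ‖deriv (fun s => g (Function.update x i s)) t‖ₑ
      ≤ ∑ j, ‖Dc j g (Function.update x i t)‖ₑ := by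
    intro t
    rw [(Dc_hasDerivAt i hg x t).deriv]
    exact Finset.single_le_sum (f := fun j => ‖Dc j g (Function.update x i t)‖ₑ)
      (fun _ _ => zero_le) (Finset.mem_univ i)
  have h3 := enorm_le_Ioi (update_cd i hg x) (update_cs i h2 x) (x i)
  simp only [Function.update_eq_self] at h3
  refine h3.trans ((lintegral_mono hD).trans ?_)
  refine lintegral_mono_set ?_
  unfold Sset
  split_ifs with hi
  · subst hi
    exact Set.Ioi_subset_Ioi (le_of_lt hx)
  · exact Set.subset_univ _

lemma Dc_add {N : ℕ} (i : Fin N) {f g : (Fin N → ℝ) → ℝ} (hf : ContDiff ℝ 1 f)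
    (hg : ContDiff ℝ 1 g) (x : Fin N → ℝ) :
    Dc i (fun z => f z + g z) x = Dc i f x + Dc i g x := by
  unfold Dc
  rw [fderiv_fun_add (hf.differentiable one_ne_zero x) (hg.differentiable one_ne_zero x)]
  rfl

lemma Dc_mul {N : ℕ} (i : Fin N) {f g : (Fin N → ℝ) → ℝ} (hf : ContDiff ℝ 1 f)
    (hg : ContDiff ℝ 1 g) (x : Fin N → ℝ) :
    Dc i (fun z => f z * g z) x = f x * Dc i g x + Dc i f x * g x := by
  unfold Dc
  rw [fderiv_fun_mul (hf.differentiable one_ne_zero x) (hg.differentiable one_ne_zero x)]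
  simp [mul_comm]

lemma rpow_cd {N : ℕ} {v : (Fin N → ℝ) → ℝ} (hv : ContDiff ℝ 1 v) {s : ℝ} (hs : 1 ≤ s) :
    ContDiff ℝ 1 (fun z => v z ^ s) := by
  have h := Real.contDiff_rpow_const_of_le (p := s) (n := 1) (by simpa using hs)
  exact (by simpa using h : ContDiff ℝ 1 (fun x : ℝ => x ^ s)).comp hv

lemma Dc_rpow {N : ℕ} (i : Fin N) {v : (Fin N → ℝ) → ℝ} (hv : ContDiff ℝ 1 v) {s : ℝ} (hs : 1 ≤ s)
    (x : Fin N → ℝ) : Dc i (fun z => v z ^ s) x = s * v x ^ (s - 1) * Dc i v x := by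
  unfold Dc
  rw [((hv.differentiable one_ne_zero x).hasFDerivAt.rpow_const (Or.inr hs)).fderiv]
  simp

lemma Dc_cut {N : ℕ} (i : Fin N) {η v : (Fin N → ℝ) → ℝ} (hη : ContDiff ℝ 1 η)
    (hv : ContDiff ℝ 1 v) {s : ℝ} (hs : 1 ≤ s) (x : Fin N → ℝ) :
    Dc i (fun z => (η z * η z) * v z ^ s) x =
      2 * η x * Dc i η x * v x ^ s + η x ^ 2 * (s * v x ^ (s - 1) * Dc i v x) := by
  rw [Dc_mul i (hη.mul hη) (rpow_cd hv hs), Dc_rpow i hv hs, Dc_mul i hη hη]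
  ring

lemma scalar1 {G v η ρ R s d e : ℝ} (hG : 0 ≤ G) (hρ1 : 1 ≤ ρ) (hρR : ρ ≤ R)
    (hs : 2 ≤ s) :
    G * ((3/4) * (s-1) * (η^2 * d^2) - 4 * R * (e^2 * v^2)) ≤
      ρ * d * (2 * η * e * (G * v) + η^2 * ((s-1) * G * d)) := by
  have : ρ * d * (2 * η * e * (G * v) + η^2 * ((s-1) * G * d)) =
    G * (ρ * ((s-1) * (η^2 * d^2) + 2 * (η * d) * (e * v))) := by ring
  rw [this]
  apply mul_le_mul_of_nonneg_left _ hG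
  have h1 : (3/4) * (s-1) * (η^2 * d^2) - 4 * (e^2 * v^2) ≤
      (s-1) * (η^2 * d^2) + 2 * (η * d) * (e * v) := by
    nlinarith [sq_nonneg (η * d / 2 + 2 * (e * v)), mul_nonneg (by linarith : 0 ≤ s - 2) (sq_nonneg (η*d))]
  have h2 : ρ * ((3/4) * (s-1) * (η^2 * d^2) - 4 * (e^2 * v^2)) ≤
      ρ * ((s-1) * (η^2 * d^2) + 2 * (η * d) * (e * v)) :=
    mul_le_mul_of_nonneg_left h1 (by linarith)
  have h3 : 0 ≤ (ρ - 1) * ((s-1) * (η^2 * d^2)) :=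
    mul_nonneg (by linarith) (mul_nonneg (by linarith) (by positivity))
  have h4 : 0 ≤ (R - ρ) * (e^2 * v^2) := mul_nonneg (by linarith) (by positivity)
  nlinarith

lemma scalar2 {G v η K s d e : ℝ} (hG : 0 ≤ G) (hK : 0 ≤ K)
    (hs : 2 ≤ s) (hη0 : 0 ≤ η) (hη1 : η ≤ 1) :
    G * (- K * (1 + e^2) * v^2 - (s-1)/4 * (η^2 * d^2) - 2 * s * K^2 * v^2) ≤
      K * (2 * η * e * (G * v^2) + η^2 * (s * (G * v) * d)) := by
  have : K * (2 * η * e * (G * v^2) + η^2 * (s * (G * v) * d)) =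
    G * (K * (2 * (η * e)) * v^2 + s * (η^2 * (K * v * d))) := by ring
  rw [this]
  apply mul_le_mul_of_nonneg_left _ hG
  have hη2 : η^2 ≤ 1 := by nlinarith
  have h1 : -(1 + e^2) ≤ 2 * (η * e) := by nlinarith [sq_nonneg (η + e)]
  have h2 : K * (-(1 + e^2)) * v^2 ≤ K * (2 * (η * e)) * v^2 := by gcongr
  have h3 : -(d^2/8) - 2 * (K^2 * v^2) ≤ K * v * d := by
    nlinarith [sq_nonneg (d/2 + 2 * (K * v)), sq_nonneg d, sq_nonneg (K * v)]
  have h4 : s * (η^2 * (-(d^2/8) - 2 * (K^2 * v^2))) ≤ s * (η^2 * (K * v * d)) := by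
    gcongr
  have h5 : 0 ≤ s * (1 - η^2) * (K^2 * v^2) :=
    mul_nonneg (mul_nonneg (by linarith) (by linarith)) (by positivity)
  have h6 : 0 ≤ (s - 2) * (η^2 * d^2) := mul_nonneg (by linarith) (by positivity)
  nlinarith

lemma scalar3 {G v η s d e : ℝ} (hG : 0 ≤ G)
    (hs : 2 ≤ s) (hη0 : 0 ≤ η) (hη1 : η ≤ 1) :
    |2 * η * e * (G * v^2) + η^2 * (s * (G * v) * d)| ≤
     G * ((1 + e^2) * v^2 + s/2 * (η^2 * d^2 + v^2)) := by
  have hη2 : η^2 ≤ 1 := by nlinarith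
  have : 2 * η * e * (G * v^2) + η^2 * (s * (G * v) * d) =
    G * ((2 * (η * e)) * v^2 + s * (η * ((η * d) * v))) := by ring
  rw [this, abs_mul, abs_of_nonneg hG]
  apply mul_le_mul_of_nonneg_left _ hG
  refine (abs_add_le _ _).trans ?_
  apply add_le_add
  · rw [abs_mul, abs_of_nonneg (sq_nonneg v)]
    gcongr
    rw [abs_le]
    constructor <;> nlinarith [sq_nonneg (η + e), sq_nonneg (η - e)]
  · rw [abs_mul, abs_of_nonneg (by linarith : 0 ≤ s), div_mul_eq_mul_div, mul_div_assoc]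
    gcongr
    rw [abs_mul, abs_of_nonneg hη0]
    have h1 : |η * d * v| ≤ (η^2 * d^2 + v^2)/2 := by
      rw [abs_le]
      constructor <;> nlinarith [sq_nonneg (η * d + v), sq_nonneg (η * d - v)]
    calc η * |η * d * v| ≤ 1 * |η * d * v| := by gcongr
      _ ≤ _ := by linarith

set_option maxHeartbeats 1000000 in
lemma pointwise_ineq {N : ℕ} (l : Fin N) {G v η ρ R K s Λ : ℝ} (d e z : Fin N → ℝ)
    (hG : 0 ≤ G) (hv : 0 ≤ v) (hρ1 : 1 ≤ ρ) (hρR : ρ ≤ R) (hK : 0 ≤ K)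
    (hs : 2 ≤ s) (hη0 : 0 ≤ η) (hη1 : η ≤ 1) (hΛ : ∑ i, e i ^ 2 ≤ Λ) (hz : 0 ≤ ∑ i, z i) :
    ∑ i, |2 * η * e i * (G * v^2) + η^2 * (s * (G * v) * d i)| ≤
      s * (∑ i, (η^2 * (G * v) * z i +
            (2 * η * e i * (G * v) + η^2 * ((s-1) * G * d i)) * (ρ * d i))
          + K * (2 * η * e l * (G * v^2) + η^2 * (s * (G * v) * d l)))
        + (2 * N + 1 + 4 * R + K + 2 * K^2) * s^2 * (1 + Λ) * (G * v^2) := by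
  set E := ∑ i, e i ^ 2 with hE
  set Q := η^2 * ∑ i, d i ^ 2 with hQ
  have hE0 : 0 ≤ E := Finset.sum_nonneg fun i _ => sq_nonneg _
  have hR : 1 ≤ R := hρ1.trans hρR
  have hel : e l ^ 2 ≤ E :=
    Finset.single_le_sum (f := fun i => e i ^ 2) (fun i _ => sq_nonneg _) (Finset.mem_univ l)
  have hdl : η^2 * d l ^ 2 ≤ Q := by
    rw [hQ]
    gcongr
    exact Finset.single_le_sum (f := fun i => d i ^ 2) (fun i _ => sq_nonneg _) (Finset.mem_univ l)
  have hQ0 : 0 ≤ Q := le_trans (by positivity) hdl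
  have s3 : ∑ i, |2 * η * e i * (G * v^2) + η^2 * (s * (G * v) * d i)| ≤
      G * ((N + E) * v^2 + s/2 * (Q + N * v^2)) := by
    refine (Finset.sum_le_sum fun i _ => scalar3 hG hs hη0 hη1).trans (le_of_eq ?_)
    rw [← Finset.mul_sum, Finset.sum_add_distrib, ← Finset.sum_mul, ← Finset.mul_sum,
      Finset.sum_add_distrib, Finset.sum_add_distrib, ← Finset.mul_sum]
    simp [hE, hQ]
  have s1 : G * ((3/4) * (s-1) * Q - 4 * R * (E * v^2)) ≤
      ∑ i, (η^2 * (G * v) * z i +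
            (2 * η * e i * (G * v) + η^2 * ((s-1) * G * d i)) * (ρ * d i)) := by
    rw [Finset.sum_add_distrib, ← Finset.mul_sum]
    have h1 : 0 ≤ η^2 * (G * v) * ∑ i, z i := by positivity
    have h2 : ∑ i, G * ((3/4) * (s-1) * (η^2 * d i^2) - 4 * R * (e i^2 * v^2)) ≤
        ∑ i, (2 * η * e i * (G * v) + η^2 * ((s-1) * G * d i)) * (ρ * d i) := by
      refine Finset.sum_le_sum fun i _ => ?_
      have := scalar1 (v := v) (η := η) (d := d i) (e := e i) hG hρ1 hρR hs
      linarith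
    rw [← Finset.mul_sum, Finset.sum_sub_distrib, ← Finset.mul_sum, ← Finset.mul_sum,
      ← Finset.mul_sum, ← Finset.sum_mul] at h2
    linarith
  have s2 := scalar2 (v := v) (d := d l) (e := e l) hG hK hs hη0 hη1
  have s2' : G * (- K * (1 + E) * v^2 - (s-1)/4 * Q - 2 * s * K^2 * v^2) ≤
      K * (2 * η * e l * (G * v^2) + η^2 * (s * (G * v) * d l)) := by
    refine le_trans ?_ s2
    apply mul_le_mul_of_nonneg_left _ hG
    have h1 : K * (1 + e l^2) * v^2 ≤ K * (1 + E) * v^2 := by gcongr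
    have h2 : (s-1)/4 * (η^2 * d l ^2) ≤ (s-1)/4 * Q := by
      apply mul_le_mul_of_nonneg_left hdl; linarith
    linarith
  have s4 := mul_le_mul_of_nonneg_left (add_le_add s1 s2') (by linarith : 0 ≤ s)
  refine s3.trans ?_
  suffices h : G * ((N + E) * v^2 + s/2 * (Q + N * v^2)) ≤
      s * (G * ((3/4) * (s-1) * Q - 4 * R * (E * v^2)) +
        G * (- K * (1 + E) * v^2 - (s-1)/4 * Q - 2 * s * K^2 * v^2)) +
       (2 * N + 1 + 4 * R + K + 2 * K^2) * s^2 * (1 + Λ) * (G * v^2) by linarith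
  have hGQ : 0 ≤ s * (s - 2) * (G * Q) :=
    mul_nonneg (mul_nonneg (by linarith) (by linarith)) (by positivity)
  have hcoef : (N : ℝ) + E + s/2 * N + s * (4 * R * E + K * (1 + E) + 2 * s * K^2) ≤
      (2 * N + 1 + 4 * R + K + 2 * K^2) * s^2 * (1 + Λ) := by
    have hs1 : 1 ≤ s := by linarith
    have hss : s ≤ s^2 := by nlinarith
    have hs2 : 1 ≤ s^2 := by nlinarith
    have hN0 : (0:ℝ) ≤ N := Nat.cast_nonneg _
    have hL : 1 ≤ 1 + Λ := by linarith
    have a1 : (N : ℝ) * 1 * 1 ≤ N * s^2 * (1 + Λ) := by gcongr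
    have a2 : 1 * E ≤ s^2 * (1 + Λ) := by gcongr; linarith
    have a3 : (N : ℝ) * (s/2) * 1 ≤ N * s^2 * (1 + Λ) := by gcongr; linarith
    have a4 : 4 * R * s * E ≤ 4 * R * s^2 * (1 + Λ) := by gcongr; linarith
    have a5 : K * s * (1 + E) ≤ K * s^2 * (1 + Λ) := by gcongr
    have a6 : 2 * K^2 * s^2 * 1 ≤ 2 * K^2 * s^2 * (1 + Λ) := by gcongr
    linarith
  have hfin := mul_le_mul_of_nonneg_right hcoef (by positivity : 0 ≤ G * v^2)
  linarith

/-- half ball -/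
def Hb {N : ℕ} (l : Fin N) (r : ℝ) : Set (Fin N → ℝ) := {x | 0 < x l ∧ ∑ i, x i ^ 2 < r ^ 2}

lemma Hb_open {N : ℕ} (l : Fin N) (r : ℝ) : IsOpen (Hb l r) := by
  have h1 : IsOpen {x : Fin N → ℝ | 0 < x l} := isOpen_lt continuous_const (continuous_apply l)
  have h2 : IsOpen {x : Fin N → ℝ | ∑ i, x i ^ 2 < r ^ 2} :=
    isOpen_lt (by fun_prop) continuous_const
  exact h1.inter h2

lemma cball_compact {N : ℕ} (r : ℝ) : IsCompact {x : Fin N → ℝ | ∑ i, x i ^ 2 ≤ r ^ 2} := by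
  refine Metric.isCompact_of_isClosed_isBounded (isClosed_le (by fun_prop) continuous_const) ?_
  refine (Metric.isBounded_closedBall (x := (0 : Fin N → ℝ)) (r := |r|)).subset ?_
  intro x hx
  rw [Set.mem_ofPred_eq] at hx
  rw [mem_closedBall_zero_iff, pi_norm_le_iff_of_nonneg (abs_nonneg r)]
  intro i
  have : x i ^ 2 ≤ r ^ 2 := le_trans
    (Finset.single_le_sum (f := fun i => x i ^ 2) (fun i _ => sq_nonneg _) (Finset.mem_univ i)) hx
  rw [Real.norm_eq_abs]
  exact sq_le_sq.1 this

lemma Hb_intOn {N : ℕ} (l : Fin N) (r : ℝ) {f : (Fin N → ℝ) → ℝ} (hf : Continuous f) :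
    IntegrableOn f (Hb l r) :=
  (hf.continuousOn.integrableOn_compact (cball_compact r)).mono_set (fun _ hx => le_of_lt hx.2)

lemma one_step {n : ℕ} (hn : 1 ≤ n) (l : Fin (n+1)) {χ : ℝ}
    (hχ : Real.HolderConjugate ((n + 1 : ℕ) : ℝ) χ)
    {v ρ : (Fin (n+1) → ℝ) → ℝ} (hv : ContDiff ℝ 2 v) (hρ : ContDiff ℝ 1 ρ)
    {R K s Λ r r' : ℝ} (hK : 0 ≤ K) (hs : 2 ≤ s) (hr' : 0 ≤ r') (hrr : r' ≤ r)
    (h1 : ∀ x ∈ Hb l r, 0 ≤ ∑ i, Dc i (fun z => ρ z * Dc i v z) x)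
    (h2 : ∀ x, x l = 0 → ∑ i, x i ^ 2 < r^2 → 0 < v x ∧ ρ x = 1 ∧ 0 ≤ Dc l v x + K * v x)
    (h3 : ∀ x ∈ Hb l r, 0 < v x ∧ 1 ≤ ρ x ∧ ρ x ≤ R)
    {η : (Fin (n+1) → ℝ) → ℝ} (hη : ContDiff ℝ 1 η) (hη0 : ∀ x, 0 ≤ η x) (hη1 : ∀ x, η x ≤ 1)
    (hηo : ∀ x, r^2 ≤ ∑ i, x i ^ 2 → η x = 0)
    (hηi : ∀ x, ∑ i, x i ^ 2 < r'^2 → η x = 1)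
    (hηd : ∀ x ∈ Hb l r, ∑ i, Dc i η x ^ 2 ≤ Λ) :
    ∫ x in Hb l r', v x ^ (s * χ) ≤
      ((2 * ((n + 1 : ℕ) : ℝ) + 1 + 4 * R + K + 2 * K^2) * s^2 * (1 + Λ) * ∫ x in Hb l r, v x ^ s) ^ χ := by
  set C := (2 * ((n + 1 : ℕ) : ℝ) + 1 + 4 * R + K + 2 * K^2) * s^2 * (1 + Λ) with hC
  have hχ1 : 1 < χ := hχ.symm.lt
  have hv1 : ContDiff ℝ 1 v := hv.of_le (by norm_num)
  have hcs : HasCompactSupport η := by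
    refine HasCompactSupport.intro (cball_compact r) fun x hx => hηo x ?_
    rw [Set.mem_ofPred_eq, not_le] at hx
    exact hx.le
  have hdv : ∀ i, ContDiff ℝ 1 (Dc i v) := fun i => by
    unfold Dc
    exact (hv.fderiv_right (m := 1) (by norm_num)).clm_apply contDiff_const
  set g : (Fin (n+1) → ℝ) → ℝ := fun z => (η z * η z) * v z ^ s with hg
  set φ : (Fin (n+1) → ℝ) → ℝ := fun z => (η z * η z) * v z ^ (s-1) with hφ
  have hgc : ContDiff ℝ 1 g := (hη.mul hη).mul (rpow_cd hv1 (by linarith))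
  have hφc : ContDiff ℝ 1 φ := (hη.mul hη).mul (rpow_cd hv1 (by linarith))
  have hgs : HasCompactSupport g := (hcs.mul_right).mul_right
  have hφs : HasCompactSupport φ := (hcs.mul_right).mul_right
  -- the flux
  set F : Fin (n+1) → (Fin (n+1) → ℝ) → ℝ := fun i z =>
    φ z * (ρ z * Dc i v z) + (if i = l then K else 0) * g z with hF
  have hFc : ∀ i, ContDiff ℝ 1 (F i) := fun i =>
    (hφc.mul (hρ.mul (hdv i))).add (contDiff_const.mul hgc)
  have hFs : ∀ i, HasCompactSupport (F i) := fun i => (hφs.mul_right).add (hgs.mul_left)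
  have hFD : ∀ i x, Dc i (F i) x = (φ x * Dc i (fun z => ρ z * Dc i v z) x
      + Dc i φ x * (ρ x * Dc i v x)) + (if i = l then K else 0) * Dc i g x := by
    intro i x
    rw [← Dc_mul i hφc (hρ.mul (hdv i))]
    have : Dc i (fun z => (if i = l then K else 0) * g z) x = (if i = l then K else 0) * Dc i g x := by
      rw [Dc_mul i contDiff_const hgc]
      simp [Dc]
    rw [← this]
    exact Dc_add i (hφc.mul (hρ.mul (hdv i))) (contDiff_const.mul hgc) x
  have hFle : ∀ i, ∫ x, Dc i (F i) x ∂(nuH l) ≤ 0 := by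
    intro i
    refine Dc_integral_nonpos l i (hFc i) (hFs i) ?_
    rintro rfl x hx
    by_cases hxr : ∑ j, x j ^ 2 < r ^ 2
    · obtain ⟨a1, a2, a3⟩ := h2 x hx hxr
      have e1 : v x ^ s = v x ^ (s-1) * v x := by
        rw [← Real.rpow_add_one a1.ne']; congr 1; ring
      have : F i x = (η x * η x) * v x ^ (s-1) * (Dc i v x + K * v x) := by
        simp only [hF, hφ, hg, a2, if_true, e1]; ring
      rw [this]
      have := hη0 x
      have := Real.rpow_nonneg a1.le (s-1)
      positivity
    · have := hηo x (not_lt.1 hxr)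
      simp [hF, hφ, hg, this]
  -- pointwise bound
  have hpt : ∀ x, 0 < x l → ∑ i, |Dc i g x| ≤ s * ∑ i, Dc i (F i) x +
      C * (Hb l r).indicator (fun x => v x ^ s) x := by
    intro x hx
    by_cases hxr : ∑ j, x j ^ 2 < r ^ 2
    · have hxm : x ∈ Hb l r := ⟨hx, hxr⟩
      rw [Set.indicator_of_mem hxm]
      obtain ⟨a1, a2, a3⟩ := h3 x hxm
      have e1 : v x ^ (s-1) = v x ^ (s-2) * v x := by
        rw [← Real.rpow_add_one a1.ne']; congr 1; ring
      have e2 : v x ^ s = v x ^ (s-2) * v x ^ 2 := by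
        rw [← Real.rpow_natCast, ← Real.rpow_add a1]; congr 1; push_cast; ring
      have key := pointwise_ineq l (G := v x ^ (s-2)) (v := v x) (η := η x) (ρ := ρ x) (R := R)
        (K := K) (s := s) (Λ := Λ) (fun i => Dc i v x) (fun i => Dc i η x)
        (fun i => Dc i (fun z => ρ z * Dc i v z) x) (Real.rpow_nonneg a1.le _) a1.le a2 a3 hK hs
        (hη0 x) (hη1 x) (hηd x hxm) (h1 x hxm)
      have eg : ∀ i, Dc i g x = 2 * η x * Dc i η x * (v x ^ (s-2) * v x ^ 2)
          + η x ^ 2 * (s * (v x ^ (s-2) * v x) * Dc i v x) := by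
        intro i
        rw [hg, Dc_cut i hη hv1 (by linarith), e1, e2]
      have ep : ∀ i, Dc i φ x = 2 * η x * Dc i η x * (v x ^ (s-2) * v x)
          + η x ^ 2 * ((s-1) * v x ^ (s-2) * Dc i v x) := by
        intro i
        rw [hφ, Dc_cut i hη hv1 (by linarith), e1]
        congr 5
        ring
      have eF : ∑ i, Dc i (F i) x = ∑ i, (η x^2 * (v x ^ (s-2) * v x) *
            Dc i (fun z => ρ z * Dc i v z) x +
            (2 * η x * Dc i η x * (v x ^ (s-2) * v x)
              + η x^2 * ((s-1) * v x ^ (s-2) * Dc i v x)) * (ρ x * Dc i v x))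
          + K * (2 * η x * Dc l η x * (v x ^ (s-2) * v x^2)
            + η x^2 * (s * (v x ^ (s-2) * v x) * Dc l v x)) := by
        simp only [hFD]
        rw [Finset.sum_add_distrib]
        congr 1
        · refine Finset.sum_congr rfl fun i _ => ?_
          rw [ep]
          simp only [hφ, e1]
          ring
        · simp [ite_mul, eg]
      rw [eF, e2]
      simp only [eg]
      exact key
    · have hz := hηo x (not_lt.1 hxr)
      rw [Set.indicator_of_notMem (fun h => hxr h.2)]
      have eg : ∀ i, Dc i g x = 0 := by
        intro i
        rw [hg, Dc_cut i hη hv1 (by linarith), hz]; ring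
      have ep : ∀ i, Dc i φ x = 0 := by
        intro i
        rw [hφ, Dc_cut i hη hv1 (by linarith), hz]; ring
      have eF : ∀ i, Dc i (F i) x = 0 := by
        intro i
        rw [hFD, eg, ep]
        simp [hφ, hz]
      simp [eg, eF]
  have hmH : MeasurableSet {x : Fin (n+1) → ℝ | 0 < x l} :=
    measurableSet_lt measurable_const (measurable_pi_apply l)
  have hHbm : ∀ r, MeasurableSet (Hb l r) := fun r => (Hb_open l r).measurableSet
  have hvs : ∀ t : ℝ, 1 ≤ t → Continuous fun x => v x ^ t := fun t ht => (rpow_cd hv1 ht).continuous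
  have hIndInt : Integrable ((Hb l r).indicator (fun x => v x ^ s)) (nuH l) := by
    rw [nuH_eq]
    exact ((Hb_intOn l r (hvs s (by linarith))).integrable_indicator (hHbm r)).restrict
  have hIndEq : ∀ (t : ℝ) (f : (Fin (n+1) → ℝ) → ℝ), ∫ x, (Hb l t).indicator f x ∂(nuH l)
      = ∫ x in Hb l t, f x := by
    intro t f
    rw [integral_indicator (hHbm t), nuH_eq, Measure.restrict_restrict (hHbm t)]
    congr 2
    ext x; exact ⟨fun h => h.1, fun h => ⟨h, h.1⟩⟩
  have hgi : ∀ i, Integrable (fun x => |Dc i g x|) (nuH l) := fun i => (Dc_integrable l i hgc hgs).abs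
  have hA : ∫ x, ∑ i, |Dc i g x| ∂(nuH l) ≤ C * ∫ x in Hb l r, v x ^ s := by
    have hFi : Integrable (fun x => ∑ i, Dc i (F i) x) (nuH l) :=
      integrable_finsetSum _ fun i _ => Dc_integrable l i (hFc i) (hFs i)
    calc ∫ x, ∑ i, |Dc i g x| ∂(nuH l) ≤ ∫ x, (s * ∑ i, Dc i (F i) x +
        C * (Hb l r).indicator (fun x => v x ^ s) x) ∂(nuH l) := by
          refine integral_mono_ae (integrable_finsetSum _ fun i _ => hgi i)
            ((hFi.const_mul s).add (hIndInt.const_mul C)) ?_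
          rw [nuH_eq]
          exact (ae_restrict_iff' hmH).2 (Filter.Eventually.of_forall hpt)
      _ = s * ∑ i, ∫ x, Dc i (F i) x ∂(nuH l) + C * ∫ x in Hb l r, v x ^ s := by
          rw [integral_add (hFi.const_mul s) (hIndInt.const_mul C), integral_const_mul,
            integral_const_mul, hIndEq, integral_finsetSum]
          exact fun i _ => Dc_integrable l i (hFc i) (hFs i)
      _ ≤ _ := by
          have : ∑ i, ∫ x, Dc i (F i) x ∂(nuH l) ≤ 0 := Finset.sum_nonpos fun i _ => hFle i
          nlinarith
  have hnn : 0 ≤ ∫ x, ∑ i, |Dc i g x| ∂(nuH l) :=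
    integral_nonneg fun x => Finset.sum_nonneg fun i _ => abs_nonneg _
  have hsob := sobolev_lint (by omega) l hχ hgc hgs
  have hR1 : ∫⁻ x, ∑ i, ‖Dc i g x‖ₑ ∂(nuH l) = ENNReal.ofReal (∫ x, ∑ i, |Dc i g x| ∂(nuH l)) := by
    rw [ofReal_integral_eq_lintegral_ofReal (integrable_finsetSum _ fun i _ => hgi i)
      (Filter.Eventually.of_forall fun x => Finset.sum_nonneg fun i _ => abs_nonneg _)]
    refine lintegral_congr fun x => ?_
    rw [ENNReal.ofReal_sum_of_nonneg fun i _ => abs_nonneg _]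
    refine Finset.sum_congr rfl fun i _ => ?_
    rw [Real.enorm_eq_ofReal_abs]
  rw [hR1, ENNReal.ofReal_rpow_of_nonneg hnn (by linarith)] at hsob
  have hL : ENNReal.ofReal (∫ x in Hb l r', v x ^ (s * χ)) ≤ ∫⁻ x, ‖g x‖ₑ ^ χ ∂(nuH l) := by
    have hsub : Hb l r' ⊆ Hb l r := fun x hx => ⟨hx.1, lt_of_lt_of_le hx.2 (by gcongr)⟩
    rw [ofReal_integral_eq_lintegral_ofReal (Hb_intOn l r' (hvs (s * χ) (by nlinarith)))
      ((ae_restrict_iff' (hHbm r')).2 (Filter.Eventually.of_forall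
        fun x hx => Real.rpow_nonneg (h3 x (hsub hx)).1.le _))]
    have : ∫⁻ x in Hb l r', ‖g x‖ₑ ^ χ ≤ ∫⁻ x, ‖g x‖ₑ ^ χ ∂(nuH l) := by
      rw [nuH_eq]
      exact lintegral_mono_set fun x hx => hx.1
    refine le_trans (le_of_eq ?_) this
    refine setLIntegral_congr_fun (hHbm r') fun x hx => ?_
    have hvx := (h3 x (hsub hx)).1
    have hgx : g x = v x ^ s := by simp [hg, hηi x hx.2]
    simp only [hgx]
    rw [Real.enorm_eq_ofReal (Real.rpow_nonneg hvx.le _),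
      ENNReal.ofReal_rpow_of_nonneg (Real.rpow_nonneg hvx.le _) (by linarith), Real.rpow_mul hvx.le]
  have hfin := hL.trans hsob
  rw [ENNReal.ofReal_le_ofReal_iff (Real.rpow_nonneg hnn _)] at hfin
  exact hfin.trans (Real.rpow_le_rpow hnn hA (by linarith))

lemma exists_cutoff : ∃ L : ℝ, 0 ≤ L ∧ ∀ (N : ℕ) (r r' : ℝ), 0 ≤ r' → r' < r → r ≤ 2 →
    ∃ η : (Fin N → ℝ) → ℝ, ContDiff ℝ 1 η ∧ (∀ x, 0 ≤ η x) ∧ (∀ x, η x ≤ 1) ∧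
      (∀ x, r^2 ≤ ∑ i, x i ^ 2 → η x = 0) ∧
      (∀ x, ∑ i, x i ^ 2 < r'^2 → η x = 1) ∧
      (∀ x, ∑ i, x i ^ 2 < r^2 → ∑ i, Dc i η x ^ 2 ≤ L * (1 / (r^2 - r'^2))^2) := by
  have hst : ContDiff ℝ 1 Real.smoothTransition := Real.smoothTransition.contDiff (n := 1)
  have hcd : Continuous (deriv Real.smoothTransition) := hst.continuous_deriv le_rfl
  obtain ⟨B, hB⟩ := (isCompact_Icc (a := (0:ℝ)) (b := 1)).exists_bound_of_continuousOn hcd.continuousOn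
  have hB0 : 0 ≤ B := (norm_nonneg _).trans (hB 0 (by simp))
  have hB' : ∀ t, |deriv Real.smoothTransition t| ≤ B := by
    intro t
    rcases lt_trichotomy t 0 with h | h | h
    · have : Real.smoothTransition =ᶠ[𝓝 t] fun _ => 0 := by
        filter_upwards [Iio_mem_nhds h] with y hy
        exact Real.smoothTransition.zero_of_nonpos (le_of_lt hy)
      rw [this.deriv_eq]; simpa using hB0
    · exact hB t (by simp [h])
    · rcases le_or_gt t 1 with h' | h'
      · exact hB t ⟨h.le, h'⟩
      · have : Real.smoothTransition =ᶠ[𝓝 t] fun _ => 1 := by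
          filter_upwards [Ioi_mem_nhds h'] with y hy
          exact Real.smoothTransition.one_of_one_le (le_of_lt hy)
        rw [this.deriv_eq]; simpa using hB0
  refine ⟨16 * B^2, by positivity, ?_⟩
  intro N r r' hr' hrr hr2
  have hpos : 0 < r^2 - r'^2 := by nlinarith
  set c := 1 / (r^2 - r'^2) with hc
  have hc0 : 0 < c := by positivity
  have hin : ContDiff ℝ 1 (fun x : Fin N → ℝ => c * (r^2 - ∑ i, x i ^ 2)) := by fun_prop
  refine ⟨fun x => Real.smoothTransition (c * (r^2 - ∑ i, x i ^ 2)), hst.comp hin,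
    fun x => Real.smoothTransition.nonneg _, fun x => Real.smoothTransition.le_one _, ?_, ?_, ?_⟩
  · intro x hx
    apply Real.smoothTransition.zero_of_nonpos
    nlinarith
  · intro x hx
    apply Real.smoothTransition.one_of_one_le
    rw [hc, div_mul_eq_mul_div, le_div_iff₀ hpos]
    linarith
  · intro x hx
    have hD : ∀ i, Dc i (fun x : Fin N → ℝ => Real.smoothTransition (c * (r^2 - ∑ i, x i ^ 2))) x
        = deriv Real.smoothTransition (c * (r^2 - ∑ i, x i ^ 2)) * (c * (-(2 * x i))) := by
      intro i
      have h1 := Dc_hasDerivAt i (hst.comp hin) x (x i)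
      rw [Function.update_eq_self] at h1
      have h2 : HasDerivAt (fun s => c * (r^2 - ∑ j, Function.update x i s j ^ 2))
          (c * (-(2 * x i))) (x i) := by
        apply HasDerivAt.const_mul
        have h3 : HasDerivAt (fun s => ∑ j, Function.update x i s j ^ 2)
            (∑ j, if j = i then 2 * x i else 0) (x i) := by
          apply HasDerivAt.fun_sum
          intro j _
          by_cases hj : j = i
          · subst hj
            simpa using hasDerivAt_pow 2 (x j)
          · simp only [Function.update_of_ne hj, hj, if_false]
            exact hasDerivAt_const _ _
        simp only [Finset.sum_ite_eq', Finset.mem_univ, if_true] at h3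
        exact h3.const_sub (r^2)
      have h4 := ((hst.differentiable one_ne_zero _).hasDerivAt (x :=
        (c * (r^2 - ∑ j, Function.update x i (x i) j ^ 2)))).comp (x i) h2
      have h5 := h1.unique h4
      rw [Function.update_eq_self] at h5
      exact h5
    simp only [hD]
    have : ∀ i, (deriv Real.smoothTransition (c * (r^2 - ∑ i, x i ^ 2)) * (c * (-(2 * x i))))^2
       = (4 * deriv Real.smoothTransition (c * (r^2 - ∑ i, x i ^ 2)) ^2 * c^2) * x i ^ 2 := by
      intro i; ring
    simp only [this]
    rw [← Finset.mul_sum]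
    have hd2 : deriv Real.smoothTransition (c * (r^2 - ∑ i, x i ^ 2)) ^2 ≤ B^2 :=
      sq_le_sq.2 ((hB' _).trans (le_abs_self B))
    have hx4 : ∑ i, x i ^ 2 ≤ 4 := by nlinarith
    calc _ ≤ (4 * B^2 * c^2) * 4 := by
          gcongr
      _ = _ := by ring

lemma moser_seq {χ A D : ℝ} (hχ : 1 < χ) (hA : 1 ≤ A) (hD : 1 ≤ D) :
    ∃ S > (0:ℝ), ∀ I : ℕ → ℝ, (∀ k, 0 ≤ I k) → (∀ k, I (k+1) ≤ (A * D^k * I k) ^ χ) →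
      ∀ k, I k ^ (1 / (4 * χ^k)) ≤ S * I 0 ^ (1/4 : ℝ) := by
  have hχ0 : 0 < χ := by linarith
  set a : ℕ → ℝ := fun j => (Real.log A + j * Real.log D) / (4 * χ^j) with ha
  have hlA := Real.log_nonneg hA
  have hlD := Real.log_nonneg hD
  have ha0 : ∀ j, 0 ≤ a j := fun j => by simp only [ha]; positivity
  have hinv : ‖χ⁻¹‖ < 1 := by
    rw [Real.norm_eq_abs, abs_of_pos (by positivity)]
    exact inv_lt_one_of_one_lt₀ hχ
  have hsum : Summable a := by
    have h1 : Summable (fun j : ℕ => (Real.log A / 4) * (χ⁻¹)^j) :=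
      (summable_geometric_of_norm_lt_one hinv).mul_left _
    have h2 : Summable (fun j : ℕ => (Real.log D / 4) * ((j:ℝ)^1 * (χ⁻¹)^j)) :=
      (summable_pow_mul_geometric_of_norm_lt_one 1 hinv).mul_left _
    refine (h1.add h2).congr fun j => ?_
    simp only [ha, inv_pow]
    field_simp
    try ring
  refine ⟨Real.exp (∑' j, a j), Real.exp_pos _, ?_⟩
  intro I hI hstep
  have hind : ∀ k, I k ^ (1 / (4 * χ^k)) ≤ Real.exp (∑ j ∈ Finset.range k, a j) * I 0 ^ (1/4 : ℝ) := by
    intro k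
    induction k with
    | zero => simp
    | succ k ih =>
      have hsk : 0 < 4 * χ^k := by positivity
      have hADk : 0 < A * D^k := by positivity
      have e1 : (A * D^k) ^ (1 / (4 * χ^k)) = Real.exp (a k) := by
        rw [Real.rpow_def_of_pos hADk, Real.log_mul (by positivity) (by positivity), Real.log_pow]
        simp only [ha]
        congr 1
        ring
      calc I (k+1) ^ (1 / (4 * χ^(k+1))) ≤ ((A * D^k * I k) ^ χ) ^ (1 / (4 * χ^(k+1))) :=
            Real.rpow_le_rpow (hI _) (hstep k) (by positivity)
        _ = (A * D^k * I k) ^ (1 / (4 * χ^k)) := by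
            rw [← Real.rpow_mul (mul_nonneg hADk.le (hI k))]
            congr 1
            rw [pow_succ]
            field_simp
        _ = Real.exp (a k) * I k ^ (1 / (4 * χ^k)) := by
            rw [Real.mul_rpow hADk.le (hI k), e1]
        _ ≤ Real.exp (a k) * (Real.exp (∑ j ∈ Finset.range k, a j) * I 0 ^ (1/4 : ℝ)) := by
            gcongr
        _ = _ := by
            rw [Finset.sum_range_succ, Real.exp_add]; ring
  intro k
  refine (hind k).trans ?_
  have := Real.rpow_nonneg (hI 0) (1/4)
  gcongr
  exact hsum.sum_le_tsum _ (fun j _ => ha0 j)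

lemma moser_limit {χ m c T : ℝ} (hχ : 1 < χ) (hm : 0 < m) (hc : 0 < c) {I : ℕ → ℝ}
    (h1 : ∀ k, c * m ^ (4 * χ^k) ≤ I k) (h2 : ∀ k, I k ^ (1 / (4 * χ^k)) ≤ T) : m ≤ T := by
  have hχ0 : 0 < χ := by linarith
  have h3 : ∀ k : ℕ, c ^ (1 / (4 * χ^k)) * m ≤ T := by
    intro k
    have hsk : 0 < 4 * χ^k := by positivity
    refine le_trans ?_ (h2 k)
    calc c ^ (1 / (4 * χ^k)) * m = (c * m ^ (4 * χ^k)) ^ (1 / (4 * χ^k)) := by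
          rw [Real.mul_rpow hc.le (by positivity), ← Real.rpow_mul hm.le, mul_one_div_cancel hsk.ne',
            Real.rpow_one]
      _ ≤ _ := Real.rpow_le_rpow (by positivity) (h1 k) (by positivity)
  have h4 : Tendsto (fun k : ℕ => 1 / (4 * χ^k)) atTop (𝓝 0) := by
    have := (tendsto_pow_atTop_atTop_of_one_lt hχ).const_mul_atTop (by norm_num : (0:ℝ) < 4)
    simp only [one_div]
    exact this.inv_tendsto_atTop
  have h5 : Tendsto (fun k : ℕ => c ^ (1 / (4 * χ^k)) * m) atTop (𝓝 (c ^ (0:ℝ) * m)) :=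
    ((Real.continuousAt_const_rpow hc.ne').tendsto.comp h4).mul_const m
  rw [Real.rpow_zero, one_mul] at h5
  exact le_of_tendsto' h5 h3

lemma core {n : ℕ} (hn : 1 ≤ n) (l : Fin (n+1)) {R K : ℝ} (hR : 0 ≤ R) (hK : 0 ≤ K) :
    ∃ C > (0:ℝ), ∀ v ρ : (Fin (n+1) → ℝ) → ℝ, ContDiff ℝ 2 v → ContDiff ℝ 1 ρ →
    (∀ x ∈ Hb l 2, 0 ≤ ∑ i, Dc i (fun z => ρ z * Dc i v z) x) →
    (∀ x, x l = 0 → ∑ i, x i ^ 2 < 2^2 → 0 < v x ∧ ρ x = 1 ∧ 0 ≤ Dc l v x + K * v x) →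
    (∀ x ∈ Hb l 2, 0 < v x ∧ 1 ≤ ρ x ∧ ρ x ≤ R) →
    ∀ x, 0 ≤ x l → ∑ i, x i ^ 2 ≤ 1 → v x ≤ C * (∫ z in Hb l 2, v z ^ (4:ℝ)) ^ (1/4 : ℝ) := by
  have hn1 : (1:ℝ) < ((n+1 : ℕ) : ℝ) := by exact_mod_cast (by omega)
  set χ := Real.conjExponent ((n+1 : ℕ) : ℝ) with hχdef
  have hχ : Real.HolderConjugate ((n+1 : ℕ) : ℝ) χ := Real.HolderConjugate.conjExponent hn1
  have hχ1 : 1 < χ := hχ.symm.lt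
  obtain ⟨L, hL0, hL⟩ := exists_cutoff
  set C2 := 2 * ((n + 1 : ℕ) : ℝ) + 1 + 4 * R + K + 2 * K^2 with hC2
  have hC21 : 1 ≤ C2 := by
    rw [hC2]
    have : 0 ≤ 2 * K^2 := by positivity
    linarith
  have hA : 1 ≤ C2 * 16 * (1 + 4 * L) := by nlinarith [mul_nonneg (by linarith : 0 ≤ C2) hL0]
  have hD : 1 ≤ 4 * χ^2 := by nlinarith
  obtain ⟨S, hS, hmos⟩ := moser_seq hχ1 hA hD
  refine ⟨S, hS, ?_⟩
  intro v ρ hv hρ h1 h2 h3 x0 hx0 hx1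
  set r : ℕ → ℝ := fun k => (3 + (1/2:ℝ)^k)/2 with hr
  have hp0 : ∀ k : ℕ, 0 < (1/2:ℝ)^k := fun k => by positivity
  have hp1 : ∀ k : ℕ, (1/2:ℝ)^k ≤ 1 := fun k => pow_le_one₀ (by norm_num) (by norm_num)
  have hr2 : ∀ k, r k ≤ 2 := fun k => by simp only [hr]; linarith [hp1 k]
  have hr32 : ∀ k, 3/2 < r k := fun k => by simp only [hr]; linarith [hp0 k]
  have hsub : ∀ k, Hb l (r k) ⊆ Hb l 2 := fun k x hx =>
    ⟨hx.1, lt_of_lt_of_le hx.2 (by have := hr2 k; have := hr32 k; gcongr)⟩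
  have hv1 : ContDiff ℝ 1 v := hv.of_le (by norm_num)
  set I : ℕ → ℝ := fun k => ∫ x in Hb l (r k), v x ^ (4 * χ^k) with hI
  have hs4 : ∀ k : ℕ, 4 ≤ 4 * χ^k := fun k => by
    have : 1 ≤ χ^k := one_le_pow₀ hχ1.le
    linarith
  have hHbm : ∀ r, MeasurableSet (Hb l r) := fun r => (Hb_open l r).measurableSet
  have hI0 : ∀ k, 0 ≤ I k := fun k =>
    setIntegral_nonneg (hHbm _) fun x hx => Real.rpow_nonneg (h3 x (hsub k hx)).1.le _
  have hstep : ∀ k, I (k+1) ≤ (C2 * 16 * (1 + 4 * L) * (4 * χ^2)^k * I k) ^ χ := by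
    intro k
    have hrk : r (k+1) = (3 + (1/2:ℝ)^k/2)/2 := by simp only [hr, pow_succ]; ring
    have hrk0 : r k = (3 + (1/2:ℝ)^k)/2 := rfl
    have hlt : r (k+1) < r k := by rw [hrk, hrk0]; linarith [hp0 k]
    obtain ⟨η, e1, e2, e3, e4, e5, e6⟩ := hL (n+1) (r k) (r (k+1)) (by linarith [hr32 (k+1)]) hlt (hr2 k)
    have hgap : (1/2:ℝ)^k / 2 ≤ r k ^ 2 - r (k+1)^2 := by
      rw [hrk, hrk0]; nlinarith [hp0 k]
    have hinv : (1 / (r k ^ 2 - r (k+1)^2))^2 ≤ 4 * 4^k := by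
      have h : 1 / (r k ^ 2 - r (k+1)^2) ≤ 1 / ((1/2:ℝ)^k / 2) :=
        one_div_le_one_div_of_le (by have := hp0 k; positivity) hgap
      have h' : 1 / ((1/2:ℝ)^k / 2) = 2 * 2^k := by
        rw [one_div_pow]; field_simp
      rw [h'] at h
      have h0 : 0 ≤ 1 / (r k ^ 2 - r (k+1)^2) := by
        have : 0 < r k ^ 2 - r (k+1)^2 := lt_of_lt_of_le (by have := hp0 k; positivity) hgap
        positivity
      calc _ ≤ (2 * 2^k : ℝ)^2 := by gcongr
        _ = 4 * 4^k := by rw [mul_pow, ← pow_mul, mul_comm k 2, pow_mul]; norm_num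
    have hos := one_step hn l hχ hv hρ (R := R) (K := K) (s := 4 * χ^k) (Λ := 4 * L * 4^k)
      (r := r k) (r' := r (k+1)) hK (by linarith [hs4 k]) (by linarith [hr32 (k+1)]) hlt.le
      (fun x hx => h1 x (hsub k hx))
      (fun x hx hx' => h2 x hx (lt_of_lt_of_le hx' (by have := hr2 k; have := hr32 k; gcongr)))
      (fun x hx => h3 x (hsub k hx)) e1 e2 e3 e4 e5
      (fun x hx => (e6 x hx.2).trans (by
        calc _ ≤ L * (4 * 4^k) := by gcongr
          _ = _ := by ring))
    have hexp : 4 * χ^k * χ = 4 * χ^(k+1) := by ring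
    rw [hexp, ← hC2] at hos
    refine hos.trans ?_
    have h4k : (1:ℝ) ≤ 4^k := one_le_pow₀ (by norm_num)
    have hCs : C2 * (4 * χ^k)^2 * (1 + 4 * L * 4^k) ≤ C2 * 16 * (1 + 4 * L) * (4 * χ^2)^k := by
      calc C2 * (4 * χ^k)^2 * (1 + 4 * L * 4^k) ≤ C2 * (4 * χ^k)^2 * (4^k + 4 * L * 4^k) := by gcongr
        _ = _ := by rw [mul_pow, mul_pow, ← pow_mul, ← pow_mul, mul_comm k 2]; ring
    have hIk := hI0 k
    have : 0 ≤ C2 * (4 * χ^k)^2 * (1 + 4 * L * 4^k) * I k := by positivity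
    exact Real.rpow_le_rpow this (mul_le_mul_of_nonneg_right hCs hIk) (by linarith)
  have hfin := hmos I hI0 hstep
  have hI00 : I 0 = ∫ z in Hb l 2, v z ^ (4:ℝ) := by
    simp only [hI, hr, pow_zero, mul_one]
    norm_num
  rw [hI00] at hfin
  refine le_of_forall_lt_imp_le_of_dense fun m hm => ?_
  rcases le_or_gt m 0 with hm0 | hm0
  · refine hm0.trans (mul_nonneg hS.le (Real.rpow_nonneg ?_ _))
    rw [← hI00]; exact hI0 0
  set V : Set (Fin (n+1) → ℝ) := Hb l (3/2) ∩ {x | m < v x} with hV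
  have hVo : IsOpen V := (Hb_open l _).inter (isOpen_lt continuous_const hv.continuous)
  have hVne : V.Nonempty := by
    set γ : ℝ → (Fin (n+1) → ℝ) := fun τ => Function.update x0 l (x0 l + τ) with hγ
    have hγc : Continuous γ := continuous_const.update l (by fun_prop)
    have hγ0 : γ 0 = x0 := by simp [hγ]
    have ho : IsOpen {x : Fin (n+1) → ℝ | ∑ i, x i ^ 2 < (3/2)^2 ∧ m < v x} :=
      IsOpen.and (isOpen_lt (by fun_prop) continuous_const) (isOpen_lt continuous_const hv.continuous)
    have hev : ∀ᶠ τ in 𝓝 (0:ℝ), γ τ ∈ {x : Fin (n+1) → ℝ | ∑ i, x i ^ 2 < (3/2)^2 ∧ m < v x} := by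
      apply hγc.continuousAt.eventually_mem
      apply ho.mem_nhds
      rw [hγ0]
      exact ⟨lt_of_le_of_lt hx1 (by norm_num), hm⟩
    obtain ⟨τ, hτ1, hτ2⟩ := ((hev.filter_mono (nhdsWithin_le_nhds (s := Set.Ioi 0))).and
      self_mem_nhdsWithin).exists
    refine ⟨γ τ, ⟨?_, hτ1.1⟩, hτ1.2⟩
    have : 0 < τ := hτ2
    simp only [hγ, Function.update_self]
    linarith
  have hVpos : 0 < volume V := hVo.measure_pos volume hVne
  have hVfin : volume V ≠ ⊤ := by
    refine ne_top_of_le_ne_top (cball_compact (N := n+1) (3/2)).measure_lt_top.ne (measure_mono ?_)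
    intro x hx
    exact le_of_lt hx.1.2
  refine moser_limit (I := I) (c := (volume V).toReal) hχ1 hm0 (ENNReal.toReal_pos hVpos.ne' hVfin) ?_ hfin
  intro k
  have hVsub : V ⊆ Hb l (r k) := fun x hx =>
    ⟨hx.1.1, lt_trans hx.1.2 (by have := hr32 k; gcongr)⟩
  have hInt4 : IntegrableOn (fun x => v x ^ (4 * χ^k)) (Hb l (r k)) :=
    Hb_intOn l _ (rpow_cd hv1 (by linarith [hs4 k])).continuous
  calc (volume V).toReal * m ^ (4 * χ^k) = ∫ x in V, m ^ (4 * χ^k) := by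
        rw [setIntegral_const, smul_eq_mul]; rfl
    _ ≤ ∫ x in V, v x ^ (4 * χ^k) := by
        refine setIntegral_mono_on (integrableOn_const hVfin) (hInt4.mono_set hVsub) hVo.measurableSet ?_
        intro x hx
        exact Real.rpow_le_rpow hm0.le (le_of_lt hx.2) (by linarith [hs4 k])
    _ ≤ I k := by
        refine setIntegral_mono_set hInt4 ?_ (Filter.Eventually.of_forall hVsub)
        exact (ae_restrict_iff' (hHbm _)).2 (Filter.Eventually.of_forall fun x hx =>
          Real.rpow_nonneg (h3 x (hsub k hx)).1.le _)

lemma pd_toLp (N : ℕ) (u : EuclideanSpace ℝ (Fin N) → ℝ) (i : Fin N) (x : Fin N → ℝ) :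
    pd N u i (WithLp.toLp 2 x) = Dc i (fun z => u (WithLp.toLp 2 z)) x := by
  unfold pd Dc
  have := ContinuousLinearEquiv.comp_right_fderiv (f := u) (x := x)
    (PiLp.continuousLinearEquiv 2 ℝ (fun _ : Fin N => ℝ)).symm
  have e : (u ∘ (PiLp.continuousLinearEquiv 2 ℝ (fun _ : Fin N => ℝ)).symm)
     = fun z => u (WithLp.toLp 2 z) := rfl
  rw [e] at this
  rw [this]
  rfl

end Helpers

theorem stmt18 (N : ℕ) (hN : 3 ≤ N) (b q M : ℝ) (hb : 0 < b) (hq1 : 2 ≤ q)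
    (hq2 : q ≤ 2 * ((N : ℝ) - 1) / ((N : ℝ) - 2)) (hM : 0 < M) :
    ∀ R : ℝ, 0 < R →
    ∃ θ₀ > (3 : ℝ), ∃ C > (0 : ℝ),
      ∀ γ : ℝ, 1 < γ →
      ∀ ρ : ℝ → ℝ, ContDiff ℝ 1 ρ → ρ 0 = 1 →
        (∀ s : ℝ, 0 ≤ s → (1 + s) ^ γ ≤ ρ s) →
        (∀ s : ℝ, 0 ≤ s → s ≤ 3 → ρ s ≤ R) →
      ∀ a p δ : ℝ, a ≤ 0 → 1 < p → 1 < δ → δ < 2 →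
      ∀ u : EuclideanSpace ℝ (Fin N) → ℝ, ContDiff ℝ 2 u →
        IsSolutionP0 N (by omega) ρ a b p q u →
        (∀ x, 0 ≤ xN N (by omega) x → ‖x‖ < 3 * δ → 0 < u x ∧ u x ≤ M) →
        ∀ (x : EuclideanSpace ℝ (Fin N)) (y : EuclideanSpace ℝ (Fin (N - 1))),
          0 ≤ xN N (by omega) x → ‖x‖ ≤ 1 → ‖y‖ ≤ 1 →
          u x + u (bPt N y) ≤ C *
            ((∫ z in {z : EuclideanSpace ℝ (Fin N) |
                0 < xN N (by omega) z ∧ ‖z‖ < 2}, u z ^ θ₀) +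
              ∫ w in {w : EuclideanSpace ℝ (Fin (N - 1)) | ‖w‖ < 2},
                u (bPt N w) ^ θ₀) ^ (1 / θ₀) := by

  intro R hR
  obtain ⟨n, rfl⟩ : ∃ n, N = n + 1 := ⟨N - 1, by omega⟩
  set l : Fin (n+1) := ⟨n + 1 - 1, Nat.sub_lt (by omega) Nat.one_pos⟩ with hl
  have hK0 : 0 ≤ b * M ^ (q - 2) := mul_nonneg hb.le (Real.rpow_nonneg hM.le _)
  obtain ⟨C, hC, hcore⟩ := core (n := n) (by omega) l hR.le hK0
  refine ⟨4, by norm_num, 2 * C, by positivity, ?_⟩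
  intro γ hγ ρ hρ hρ0 hρ1 hρR a p δ ha hp hδ1 hδ2 u hu hsol hpos x y hx0 hx1 hy1
  set v : (Fin (n+1) → ℝ) → ℝ := fun z => u (WithLp.toLp 2 z) with hv
  have hnorm : ∀ z : Fin (n+1) → ℝ, ‖(WithLp.toLp 2 z : EuclideanSpace ℝ (Fin (n+1)))‖ ^ 2
      = ∑ i, z i ^ 2 := by
    intro z
    rw [EuclideanSpace.real_norm_sq_eq]
  have hlt : ∀ z : Fin (n+1) → ℝ, ∑ i, z i ^ 2 < 2 ^ 2 →
      ‖(WithLp.toLp 2 z : EuclideanSpace ℝ (Fin (n+1)))‖ < 2 := by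
    intro z hz
    rw [← hnorm] at hz
    exact lt_of_pow_lt_pow_left₀ 2 (by norm_num) hz
  have hposv : ∀ z : Fin (n+1) → ℝ, 0 ≤ z l → ∑ i, z i ^ 2 < 2 ^ 2 → 0 < v z ∧ v z ≤ M := by
    intro z hz hz2
    exact hpos (WithLp.toLp 2 z) hz (by linarith [hlt z hz2])
  have hvc : ContDiff ℝ 2 v :=
    hu.comp (PiLp.continuousLinearEquiv 2 ℝ (fun _ : Fin (n+1) => ℝ)).symm.contDiff
  have hρc : ContDiff ℝ 1 (fun z : Fin (n+1) → ℝ => ρ (z l)) := hρ.comp (contDiff_apply ℝ ℝ l)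
  have hmain := hcore v (fun z => ρ (z l)) hvc hρc ?_ ?_ ?_
  rotate_left
  · intro z hz
    have h1 := hsol.1 (WithLp.toLp 2 z) hz.1
    have h2 : divW (n+1) (fun z => ρ (xN (n+1) (by omega) z)) u (WithLp.toLp 2 z)
        = ∑ i, Dc i (fun z => ρ (z l) * Dc i v z) z := by
      unfold divW
      refine Finset.sum_congr rfl fun i _ => ?_
      rw [pd_toLp]
      congr 1
      funext w
      rw [pd_toLp]
      rfl
    rw [h2] at h1
    have h3 := (hposv z hz.1.le hz.2).1
    have h4 : 0 ≤ (-a) * |u (WithLp.toLp 2 z)| ^ (p - 2) * u (WithLp.toLp 2 z) := by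
      have : 0 ≤ -a := by linarith
      have h5 : 0 ≤ u (WithLp.toLp 2 z) := h3.le
      positivity
    linarith
  · intro z hz hz2
    have h3 := hposv z hz.ge hz2
    refine ⟨h3.1, by simp only [hz, hρ0], ?_⟩
    have h1 := hsol.2 (WithLp.toLp 2 fun j : Fin (n + 1 - 1) => z ⟨j, by omega⟩)
    have h2 : bPt (n+1) (WithLp.toLp 2 fun j : Fin (n + 1 - 1) => z ⟨j, by omega⟩)
        = WithLp.toLp 2 z := by
      ext i
      simp only [bPt, mkPt]
      change (if h : (i:ℕ) < n + 1 - 1 then z ⟨i, _⟩ else 0) = z i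
      split_ifs with h
      · rfl
      · have : i = l := by
          apply Fin.ext
          have := i.2
          simp only [hl]
          omega
        rw [this, hz]
    rw [h2, pd_toLp] at h1
    change -Dc l v z = b * |v z| ^ (q-2) * v z at h1
    rw [abs_of_pos h3.1] at h1
    have h4 : v z ^ (q-2) ≤ M ^ (q-2) := Real.rpow_le_rpow h3.1.le h3.2 (by linarith)
    have h5 : b * v z ^ (q-2) * v z ≤ b * M ^ (q-2) * v z :=
      mul_le_mul_of_nonneg_right (mul_le_mul_of_nonneg_left h4 hb.le) h3.1.le
    linarith
  · intro z hz
    refine ⟨(hposv z hz.1.le hz.2).1, ?_, ?_⟩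
    · refine le_trans ?_ (hρ1 (z l) hz.1.le)
      exact Real.one_le_rpow (by linarith [hz.1]) (by linarith)
    · refine hρR (z l) hz.1.le ?_
      have : z l ^ 2 ≤ ∑ i, z i ^ 2 :=
        Finset.single_le_sum (f := fun i => z i ^ 2) (fun i _ => sq_nonneg _) (Finset.mem_univ l)
      nlinarith [hz.2]
  have hInt4 : ∫ z in Hb l 2, v z ^ (4:ℝ) = ∫ z in {z : EuclideanSpace ℝ (Fin (n+1)) |
      0 < xN (n+1) (by omega) z ∧ ‖z‖ < 2}, u z ^ (4:ℝ) := by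
    have mp := PiLp.volume_preserving_toLp (Fin (n+1))
    rw [← mp.setIntegral_preimage_emb (MeasurableEquiv.toLp 2 (Fin (n+1) → ℝ)).measurableEmbedding]
    congr 2
    ext z
    have : ∑ i, z i ^ 2 < 2 ^ 2 ↔ ‖(WithLp.toLp 2 z : EuclideanSpace ℝ (Fin (n+1)))‖ < 2 :=
      ⟨hlt z, fun h => by rw [← hnorm]; gcongr⟩
    simp only [Hb, Set.mem_ofPred_eq, Set.mem_preimage, this]
    rfl
  rw [hInt4] at hmain
  set I1 := ∫ z in {z : EuclideanSpace ℝ (Fin (n+1)) |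
      0 < xN (n+1) (by omega) z ∧ ‖z‖ < 2}, u z ^ (4:ℝ) with hI1
  set I2 := ∫ w in {w : EuclideanSpace ℝ (Fin (n + 1 - 1)) | ‖w‖ < 2}, u (bPt (n+1) w) ^ (4:ℝ) with hI2
  have hbn : ∀ w : EuclideanSpace ℝ (Fin (n + 1 - 1)), ‖bPt (n+1) w‖ = ‖w‖ := by
    intro w
    rw [EuclideanSpace.norm_eq, EuclideanSpace.norm_eq]
    congr 1
    change ∑ i : Fin (n+1), ‖(if h : (i:ℕ) < n + 1 - 1 then w ⟨i, h⟩ else 0)‖ ^ 2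
      = ∑ i : Fin n, ‖w i‖ ^ 2
    rw [Fin.sum_univ_castSucc]
    simp
  have hbl : ∀ w : EuclideanSpace ℝ (Fin (n + 1 - 1)), xN (n+1) (by omega) (bPt (n+1) w) = 0 := by
    intro w
    change (if h : n + 1 - 1 < n + 1 - 1 then w ⟨_, h⟩ else 0) = 0
    simp
  have hI10 : 0 ≤ I1 := by
    rw [← hInt4]
    exact setIntegral_nonneg (Hb_open l 2).measurableSet fun z hz =>
      Real.rpow_nonneg (hposv z hz.1.le hz.2).1.le _
  have hI20 : 0 ≤ I2 := by
    refine setIntegral_nonneg (measurableSet_lt measurable_norm measurable_const) fun w hw => ?_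
    refine Real.rpow_nonneg (hpos _ (hbl w).ge ?_).1.le _
    rw [hbn]
    have : ‖w‖ < 2 := hw
    linarith
  have hle : I1 ^ (1/4:ℝ) ≤ (I1 + I2) ^ (1/4:ℝ) :=
    Real.rpow_le_rpow hI10 (by linarith) (by norm_num)
  have hpt : ∀ z : EuclideanSpace ℝ (Fin (n+1)), 0 ≤ xN (n+1) (by omega) z → ‖z‖ ≤ 1 →
      u z ≤ C * I1 ^ (1/4:ℝ) := by
    intro z hz hz1
    refine hmain (WithLp.ofLp z) hz ?_
    rw [← hnorm]
    exact pow_le_one₀ (norm_nonneg _) hz1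
  have g1 := hpt x hx0 hx1
  have g2 := hpt (bPt (n+1) y) (hbl y).ge (by rw [hbn]; exact hy1)
  have g3 := mul_le_mul_of_nonneg_left hle hC.le
  linarith
end
end
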